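/- arXiv:1709.00043 — 2 statements merged into one kernel-verified Lean document; each statement's English description precedes it below -/
import Mathlib

section
/- Every bipartite outerplanar finite simple graph admits a planar straight-line drawing in which every edge has length exactly 1; in particular, its planar edge-length ratio equals 1. -/
noncomputable section

/-- The Euclidean plane. -/
abbrev Plane : Type := EuclideanSpace ℝ (Fin 2)

/-- A planar straight-line drawing of a simple graph `G`. -/
def IsPlanarDrawing {V : Type} (G : SimpleGraph V) (ρ : V → Plane) : Prop :=
  Function.Injective ρ ∧
  (∀ u v w : V, G.Adj u v → w ≠ u → w ≠ v → ρ w ∉ segment ℝ (ρ u) (ρ v)) ∧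
  (∀ u v x y : V, G.Adj u v → G.Adj x y → s(u, v) ≠ s(x, y) →
    segment ℝ (ρ u) (ρ v) ∩ segment ℝ (ρ x) (ρ y) =
      {p : Plane | ∃ w : V, (w = u ∨ w = v) ∧ (w = x ∨ w = y) ∧ p = ρ w})

/-- The edge-length ratio of a drawing: longest edge length divided by shortest. -/
def edgeLengthRatio {V : Type} (G : SimpleGraph V) (ρ : V → Plane) : ℝ :=
  sSup {d : ℝ | ∃ u v : V, G.Adj u v ∧ d = dist (ρ u) (ρ v)} /
  sInf {d : ℝ | ∃ u v : V, G.Adj u v ∧ d = dist (ρ u) (ρ v)}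

/-- A graph is outerplanar if it admits a planar straight-line drawing with all vertex
images on a common circle. -/
def IsOuterplanar {V : Type} (G : SimpleGraph V) : Prop :=
  ∃ (ρ : V → Plane) (c : Plane) (r : ℝ),
    IsPlanarDrawing G ρ ∧ ∀ v : V, dist (ρ v) c = r

/-- The planar edge-length ratio of a graph: the infimum of the edge-length ratios over
all its planar straight-line drawings. -/
def planarEdgeLengthRatio {V : Type} (G : SimpleGraph V) : ℝ :=
  sInf {r : ℝ | ∃ ρ : V → Plane, IsPlanarDrawing G ρ ∧ r = edgeLengthRatio G ρ}


open Set Filter Topology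

theorem segment_inter_segment_of_notMem {a b c : Plane} (hb : b ∉ segment ℝ a c)
    (hc : c ∉ segment ℝ a b) : segment ℝ a b ∩ segment ℝ a c = {a} := by
  refine Subset.antisymm ?_ (singleton_subset_iff.2
    ⟨left_mem_segment ℝ a b, left_mem_segment ℝ a c⟩)
  rintro z ⟨h₁, h₂⟩
  rw [segment_eq_image'] at h₁ h₂ hb hc
  obtain ⟨l, ⟨hl0, hl1⟩, rfl⟩ := h₁
  obtain ⟨m, ⟨hm0, hm1⟩, hm⟩ := h₂
  have h : m • (c - a) = l • (b - a) := by simpa using hm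
  rcases hl0.eq_or_lt with rfl | hl
  · simp
  rcases hm0.eq_or_lt with rfl | hm'
  · simp only [mem_singleton_iff]
    rw [← h]
    simp
  exfalso
  rcases le_total l m with hlm | hlm
  · refine hc ⟨l / m, ⟨by positivity, (div_le_one hm').2 hlm⟩, ?_⟩
    have : (l / m) • (b - a) = c - a := by
      rw [div_eq_inv_mul, mul_smul, ← h, smul_smul, inv_mul_cancel₀ hm'.ne', one_smul]
    simp only [this]
    abel
  · refine hb ⟨m / l, ⟨by positivity, (div_le_one hl).2 hlm⟩, ?_⟩
    have : (m / l) • (c - a) = b - a := by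
      rw [div_eq_inv_mul, mul_smul, h, smul_smul, inv_mul_cancel₀ hl.ne', one_smul]
    simp only [this]
    abel

/-- Planarity only has to be checked for a vertex and a nonincident edge, and for two edges
without common endpoint. -/
theorem isPlanarDrawing_of_disjoint {V : Type} {G : SimpleGraph V} {ρ : V → Plane}
    (hinj : Function.Injective ρ)
    (hvert : ∀ u v w : V, G.Adj u v → w ≠ u → w ≠ v → ρ w ∉ segment ℝ (ρ u) (ρ v))
    (hedge : ∀ u v x y : V, G.Adj u v → G.Adj x y → u ≠ x → u ≠ y → v ≠ x → v ≠ y →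
      Disjoint (segment ℝ (ρ u) (ρ v)) (segment ℝ (ρ x) (ρ y))) :
    IsPlanarDrawing G ρ := by
  have key : ∀ u v y : V, G.Adj u v → G.Adj u y → v ≠ y →
      segment ℝ (ρ u) (ρ v) ∩ segment ℝ (ρ u) (ρ y) = {ρ u} := fun u v y huv huy hvy =>
    segment_inter_segment_of_notMem (hvert u y v huy huv.ne' hvy)
      (hvert u v y huv huy.ne' hvy.symm)
  refine ⟨hinj, hvert, fun u v x y huv hxy hne => ?_⟩
  have := huv.ne
  have := hxy.ne
  have sub : ∀ z : V, (∀ w, (w = u ∨ w = v) ∧ (w = x ∨ w = y) ↔ w = z) →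
      {p : Plane | ∃ w : V, (w = u ∨ w = v) ∧ (w = x ∨ w = y) ∧ p = ρ w} = {ρ z} := by
    intro z hz
    ext p
    simp only [← and_assoc, hz, mem_ofPred_eq, exists_eq_left, mem_singleton_iff]
  rw [ne_eq, Sym2.eq_iff] at hne
  by_cases h₁ : u = x
  · subst h₁
    rw [key u v y huv hxy (by grind), sub u (by grind)]
  by_cases h₂ : u = y
  · subst h₂
    rw [segment_symm ℝ (ρ x), key u v x huv hxy.symm (by grind), sub u (by grind)]
  by_cases h₃ : v = x
  · subst h₃
    rw [segment_symm ℝ (ρ u), key v u y huv.symm hxy (by grind), sub v (by grind)]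
  by_cases h₄ : v = y
  · subst h₄
    rw [segment_symm ℝ (ρ u), segment_symm ℝ (ρ x), key v u x huv.symm hxy.symm (by grind),
      sub v (by grind)]
  rw [(hedge u v x y huv hxy h₁ h₂ h₃ h₄).inter_eq, eq_comm, eq_empty_iff_forall_notMem]
  rintro p ⟨w, h, h', -⟩
  grind

/-- The endpoint of a path of unit vectors whose heights are `s * t`, for `t` in `M`. -/
def unitPathEnd (s : ℝ) (M : Multiset ℝ) : Plane :=
  !₂[(M.map fun t => √(1 - (s * t) ^ 2)).sum, s * M.sum]

theorem dist_unitPathEnd_cons {s t : ℝ} (h : (s * t) ^ 2 ≤ 1) (M : Multiset ℝ) :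
    dist (unitPathEnd s M) (unitPathEnd s (t ::ₘ M)) = 1 := by
  rw [EuclideanSpace.dist_eq, Real.sqrt_eq_one]
  simp only [unitPathEnd, Fin.sum_univ_two, Real.dist_eq, sq_abs]
  simp only [Multiset.map_cons, Multiset.sum_cons, Matrix.cons_val_zero, Matrix.cons_val_one]
  have := Real.sq_sqrt (sub_nonneg.2 h)
  linear_combination this

theorem tendsto_sum_sqrt (M : Multiset ℝ) :
    Tendsto (fun s : ℝ => (M.map fun t => √(1 - (s * t) ^ 2)).sum) (𝓝 0) (𝓝 M.card) := by
  induction M using Multiset.induction with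
  | empty => simp
  | cons a M ih =>
    simp only [Multiset.map_cons, Multiset.sum_cons, Multiset.card_cons, Nat.cast_add,
      Nat.cast_one, add_comm _ (1 : ℝ)]
    refine Tendsto.add ?_ ih
    have : Continuous fun s : ℝ => √(1 - (s * a) ^ 2) := by fun_prop
    simpa using this.tendsto 0

theorem disjoint_segment_of_lt {a b c d : Plane} (α β γ : ℝ)
    (ha : α * a 0 + β * a 1 < γ) (hb : α * b 0 + β * b 1 < γ)
    (hc : γ < α * c 0 + β * c 1) (hd : γ < α * d 0 + β * d 1) :
    Disjoint (segment ℝ a b) (segment ℝ c d) := by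
  have hlin : IsLinearMap ℝ fun p : Plane => α * p 0 + β * p 1 :=
    ⟨fun p q => by simp only [PiLp.add_apply]; ring,
      fun r p => by simp only [PiLp.smul_apply, smul_eq_mul]; ring⟩
  have h₁ := (convex_halfSpace_lt hlin γ).segment_subset ha hb
  have h₂ := (convex_halfSpace_gt hlin γ).segment_subset hc hd
  refine disjoint_left.2 fun z hz hz' => ?_
  have hlt : α * z 0 + β * z 1 < γ := h₁ hz
  exact hlt.not_gt (h₂ hz')

/-- The limit position, up to vertical scaling, of `unitPathEnd s M` as `s` tends to zero. -/
def levelPoint (M : Multiset ℝ) : ℝ × ℝ := (M.card, M.sum)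

theorem eventually_disjoint_segment {a b c d : Multiset ℝ}
    (h : Disjoint (segment ℝ (levelPoint a) (levelPoint b))
      (segment ℝ (levelPoint c) (levelPoint d))) :
    ∀ᶠ s in 𝓝[>] (0 : ℝ), Disjoint (segment ℝ (unitPathEnd s a) (unitPathEnd s b))
      (segment ℝ (unitPathEnd s c) (unitPathEnd s d)) := by
  have hcomp : ∀ x y : ℝ × ℝ, IsCompact (segment ℝ x y) := fun x y => by
    rw [segment_eq_image_lineMap]
    exact isCompact_Icc.image (by fun_prop)
  obtain ⟨f, u, v, hu, huv, hv⟩ := geometric_hahn_banach_compact_closed (convex_segment _ _)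
    (hcomp _ _) (convex_segment _ _) (hcomp _ _).isClosed h
  have hf : ∀ M : Multiset ℝ, f (levelPoint M) = f (1, 0) * M.card + f (0, 1) * M.sum := by
    intro M
    have : levelPoint M = (M.card : ℝ) • ((1 : ℝ), (0 : ℝ)) + M.sum • ((0 : ℝ), (1 : ℝ)) := by
      simp [levelPoint]
    rw [this, map_add, map_smul, map_smul, smul_eq_mul, smul_eq_mul]
    ring
  have lim : ∀ M : Multiset ℝ, Tendsto (fun s : ℝ => f (1, 0) *
      (M.map fun t => √(1 - (s * t) ^ 2)).sum + f (0, 1) * M.sum) (𝓝[>] 0)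
      (𝓝 (f (levelPoint M))) := by
    intro M
    rw [hf]
    exact (((tendsto_sum_sqrt M).const_mul _).add_const _).mono_left nhdsWithin_le_nhds
  have ha := (lim a).eventually_lt_const (hu _ (left_mem_segment ℝ _ _))
  have hb := (lim b).eventually_lt_const (hu _ (right_mem_segment ℝ _ _))
  have hc := (lim c).eventually_const_lt (huv.trans (hv _ (left_mem_segment ℝ _ _)))
  have hd := (lim d).eventually_const_lt (huv.trans (hv _ (right_mem_segment ℝ _ _)))
  filter_upwards [ha, hb, hc, hd, self_mem_nhdsWithin] with s ha hb hc hd (hs : 0 < s)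
  have : ∀ M : Multiset ℝ, f (0, 1) / s * (s * M.sum) = f (0, 1) * M.sum := fun M => by
    field_simp
  apply disjoint_segment_of_lt (f (1, 0)) (f (0, 1) / s) u <;>
    simpa [unitPathEnd, this]

/-- A placement of the vertices in `S` at the endpoints of paths with the slopes in `P`, that is
planar when the vertices are read as points `levelPoint (P v)`. -/
structure IsLevelPlanar {α : Type} (E : α → α → Prop) (S : Set α) (P : α → Multiset ℝ) :
    Prop where
  adj : ∀ x ∈ S, ∀ y ∈ S, E x y → ∃ t, P y = t ::ₘ P x ∨ P x = t ::ₘ P y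
  inj : ∀ x ∈ S, ∀ y ∈ S, (P x).card = (P y).card → (P x).sum = (P y).sum → x = y
  mono : ∀ x ∈ S, ∀ y ∈ S, ∀ x' ∈ S, ∀ y' ∈ S, E x y → E x' y' →
    (P y).card = (P x).card + 1 → (P y').card = (P x').card + 1 →
    (P x).card = (P x').card → (P x).sum < (P x').sum → (P y).sum ≤ (P y').sum

theorem mem_segment_levelPoint {M N : Multiset ℝ} (h : N.card = M.card + 1) {z : ℝ × ℝ}
    (hz : z ∈ segment ℝ (levelPoint M) (levelPoint N)) :
    ∃ l : ℝ, 0 ≤ l ∧ l ≤ 1 ∧ z.1 = M.card + l ∧ z.2 = (1 - l) * M.sum + l * N.sum := by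
  rw [segment_eq_image] at hz
  obtain ⟨l, ⟨h0, h1⟩, rfl⟩ := hz
  refine ⟨l, h0, h1, ?_, ?_⟩
  · simp [levelPoint, h]
    ring
  · simp [levelPoint]

namespace IsLevelPlanar

variable {α : Type} {E : α → α → Prop} {S : Set α} {P : α → Multiset ℝ}

theorem disjoint_vertex (h : IsLevelPlanar E S P) {u v w : α} (hu : u ∈ S) (hv : v ∈ S)
    (hw : w ∈ S) (huv : (P v).card = (P u).card + 1) (hwu : w ≠ u) (hwv : w ≠ v) :
    Disjoint (segment ℝ (levelPoint (P w)) (levelPoint (P w)))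
      (segment ℝ (levelPoint (P u)) (levelPoint (P v))) := by
  rw [segment_same, disjoint_singleton_left]
  intro hz
  obtain ⟨l, h0, h1, hx, hy⟩ := mem_segment_levelPoint huv hz
  simp only [levelPoint] at hx hy
  rcases lt_trichotomy (P w).card ((P u).card + 1) with hc | hc | hc
  · have hc' : ((P w).card : ℝ) ≤ (P u).card := by exact_mod_cast Nat.lt_succ_iff.1 hc
    have hl : l = 0 := by linarith
    subst hl
    refine hwu (h.inj w hw u hu ?_ (by linarith))
    exact_mod_cast (show ((P w).card : ℝ) = (P u).card by linarith)
  · have hc' : ((P w).card : ℝ) = (P u).card + 1 := by exact_mod_cast hc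
    have hl : l = 1 := by linarith
    subst hl
    exact hwv (h.inj w hw v hv (by omega) (by linarith))
  · have hc' : ((P w).card : ℝ) > (P u).card + 1 := by exact_mod_cast hc
    linarith

theorem disjoint_edge (h : IsLevelPlanar E S P) {u v x y : α} (hu : u ∈ S) (hv : v ∈ S)
    (hx : x ∈ S) (hy : y ∈ S) (huv : E u v) (hxy : E x y)
    (cuv : (P v).card = (P u).card + 1) (cxy : (P y).card = (P x).card + 1)
    (h₁ : u ≠ x) (h₂ : u ≠ y) (h₃ : v ≠ x) (h₄ : v ≠ y) :
    Disjoint (segment ℝ (levelPoint (P u)) (levelPoint (P v)))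
      (segment ℝ (levelPoint (P x)) (levelPoint (P y))) := by
  rw [disjoint_left]
  intro z hz hz'
  obtain ⟨l, hl0, hl1, hz1, hz2⟩ := mem_segment_levelPoint cuv hz
  obtain ⟨m, hm0, hm1, hz1', hz2'⟩ := mem_segment_levelPoint cxy hz'
  rw [hz1] at hz1'
  rw [hz2] at hz2'
  rcases lt_trichotomy (P u).card (P x).card with hc | hc | hc
  · have hc' : ((P u).card : ℝ) + 1 ≤ (P x).card := by exact_mod_cast hc
    obtain rfl : l = 1 := by linarith
    obtain rfl : m = 0 := by linarith
    refine h₃ (h.inj v hv x hx ?_ (by linarith))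
    rw [cuv]
    exact_mod_cast (show ((P u).card : ℝ) + 1 = (P x).card by linarith)
  · have hc' : ((P u).card : ℝ) = (P x).card := by exact_mod_cast hc
    obtain rfl : l = m := by linarith
    have hne₁ : (P u).sum ≠ (P x).sum := fun he => h₁ (h.inj u hu x hx hc he)
    have hne₂ : (P v).sum ≠ (P y).sum := fun he => h₄ (h.inj v hv y hy (by omega) he)
    rcases hne₁.lt_or_gt with hlt | hlt
    · have := (h.mono u hu v hv x hx y hy huv hxy cuv cxy hc hlt).lt_of_ne hne₂
      rcases hl0.eq_or_lt with rfl | hl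
      · linarith
      · nlinarith
    · have := (h.mono x hx y hy u hu v hv hxy huv cxy cuv hc.symm hlt).lt_of_ne hne₂.symm
      rcases hl0.eq_or_lt with rfl | hl
      · linarith
      · nlinarith
  · have hc' : ((P x).card : ℝ) + 1 ≤ (P u).card := by exact_mod_cast hc
    obtain rfl : m = 1 := by linarith
    obtain rfl : l = 0 := by linarith
    refine h₂ (h.inj u hu y hy ?_ (by linarith))
    rw [cxy]
    exact_mod_cast (show ((P u).card : ℝ) = (P x).card + 1 by linarith)

theorem exists_unit_drawing {V : Type} [Finite V] {G : SimpleGraph V} {P : V → Multiset ℝ}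
    (h : IsLevelPlanar G.Adj univ P) :
    ∃ ρ : V → Plane, IsPlanarDrawing G ρ ∧ ∀ u v : V, G.Adj u v → dist (ρ u) (ρ v) = 1 := by
  have card_or : ∀ u v, G.Adj u v →
      (P v).card = (P u).card + 1 ∨ (P u).card = (P v).card + 1 := by
    intro u v huv
    obtain ⟨t, ht | ht⟩ := h.adj u (mem_univ u) v (mem_univ v) huv
    · left; simp [ht]
    · right; simp [ht]
  have hinj : ∀ u v, u ≠ v → ∀ᶠ s in 𝓝[>] (0 : ℝ), unitPathEnd s (P u) ≠ unitPathEnd s (P v) := by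
    intro u v huv
    have : Disjoint (segment ℝ (levelPoint (P u)) (levelPoint (P u)))
        (segment ℝ (levelPoint (P v)) (levelPoint (P v))) := by
      rw [segment_same, segment_same, disjoint_singleton]
      intro he
      simp only [levelPoint, Prod.mk.injEq, Nat.cast_inj] at he
      exact huv (h.inj u (mem_univ u) v (mem_univ v) he.1 he.2)
    filter_upwards [eventually_disjoint_segment this] with s hs
    simpa [segment_same] using hs
  have hvert : ∀ u v w, G.Adj u v → w ≠ u → w ≠ v → ∀ᶠ s in 𝓝[>] (0 : ℝ),
      unitPathEnd s (P w) ∉ segment ℝ (unitPathEnd s (P u)) (unitPathEnd s (P v)) := by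
    intro u v w huv hu hv
    have : Disjoint (segment ℝ (levelPoint (P w)) (levelPoint (P w)))
        (segment ℝ (levelPoint (P u)) (levelPoint (P v))) := by
      rcases card_or u v huv with hc | hc
      · exact h.disjoint_vertex (mem_univ u) (mem_univ v) (mem_univ w) hc hu hv
      · rw [segment_symm ℝ (levelPoint (P u))]
        exact h.disjoint_vertex (mem_univ v) (mem_univ u) (mem_univ w) hc hv hu
    filter_upwards [eventually_disjoint_segment this] with s hs
    simpa [segment_same] using hs
  have hedge : ∀ u v x y, G.Adj u v → G.Adj x y → u ≠ x → u ≠ y → v ≠ x → v ≠ y →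
      ∀ᶠ s in 𝓝[>] (0 : ℝ), Disjoint (segment ℝ (unitPathEnd s (P u)) (unitPathEnd s (P v)))
        (segment ℝ (unitPathEnd s (P x)) (unitPathEnd s (P y))) := by
    intro u v x y huv hxy h₁ h₂ h₃ h₄
    apply eventually_disjoint_segment
    rcases card_or u v huv with hc | hc <;> rcases card_or x y hxy with hc' | hc'
    · exact h.disjoint_edge (mem_univ _) (mem_univ _) (mem_univ _) (mem_univ _) huv hxy hc hc'
        h₁ h₂ h₃ h₄
    · rw [segment_symm ℝ (levelPoint (P x))]
      exact h.disjoint_edge (mem_univ _) (mem_univ _) (mem_univ _) (mem_univ _) huv hxy.symm hc hc'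
        h₂ h₁ h₄ h₃
    · rw [segment_symm ℝ (levelPoint (P u))]
      exact h.disjoint_edge (mem_univ _) (mem_univ _) (mem_univ _) (mem_univ _) huv.symm hxy hc hc'
        h₃ h₄ h₁ h₂
    · rw [segment_symm ℝ (levelPoint (P u)), segment_symm ℝ (levelPoint (P x))]
      exact h.disjoint_edge (mem_univ _) (mem_univ _) (mem_univ _) (mem_univ _) huv.symm hxy.symm
        hc hc' h₄ h₃ h₂ h₁
  have small : ∀ t : ℝ, ∀ᶠ s in 𝓝[>] (0 : ℝ), (s * t) ^ 2 ≤ 1 := by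
    intro t
    have : Tendsto (fun s : ℝ => (s * t) ^ 2) (𝓝 0) (𝓝 0) := by
      have : Continuous fun s : ℝ => (s * t) ^ 2 := by fun_prop
      simpa using this.tendsto 0
    exact nhdsWithin_le_nhds (this.eventually_le_const one_pos)
  have hdist : ∀ u v, G.Adj u v → ∀ᶠ s in 𝓝[>] (0 : ℝ),
      dist (unitPathEnd s (P u)) (unitPathEnd s (P v)) = 1 := by
    intro u v huv
    obtain ⟨t, ht | ht⟩ := h.adj u (mem_univ u) v (mem_univ v) huv
    · filter_upwards [small t] with s hs
      rw [ht, dist_unitPathEnd_cons hs]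
    · filter_upwards [small t] with s hs
      rw [ht, dist_comm, dist_unitPathEnd_cons hs]
  simp only [← eventually_all] at hinj hvert hedge hdist
  obtain ⟨s, h₁, h₂, h₃, h₄⟩ := (hinj.and (hvert.and (hedge.and hdist))).exists
  exact ⟨fun v => unitPathEnd s (P v), isPlanarDrawing_of_disjoint
    (fun u v huv => by_contra fun hne => h₁ u v hne huv) h₂ h₃, h₄⟩

end IsLevelPlanar

/-- No two edges of `E` on the integer line cross when drawn as arcs in the upper half-plane. -/
def NonCrossing (E : ℤ → ℤ → Prop) : Prop :=
  ∀ a b c d : ℤ, a < b → b < c → c < d → E a c → E b d → False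

namespace IsLevelPlanar

variable {α : Type} {E : α → α → Prop} {P Q : α → Multiset ℝ}

theorem congr {S : Set α} (h : IsLevelPlanar E S P) (hPQ : ∀ x ∈ S, Q x = P x) :
    IsLevelPlanar E S Q where
  adj x hx y hy hxy := by
    rw [hPQ x hx, hPQ y hy]
    exact h.adj x hx y hy hxy
  inj x hx y hy := by
    rw [hPQ x hx, hPQ y hy]
    exact h.inj x hx y hy
  mono x hx y hy x' hx' y' hy' := by
    rw [hPQ x hx, hPQ y hy, hPQ x' hx', hPQ y' hy']
    exact h.mono x hx y hy x' hx' y' hy'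

theorem add {S : Set α} (h : IsLevelPlanar E S P) (B : Multiset ℝ) :
    IsLevelPlanar E S fun x => P x + B where
  adj x hx y hy hxy := by
    obtain ⟨t, ht | ht⟩ := h.adj x hx y hy hxy
    · exact ⟨t, Or.inl (by rw [ht, Multiset.cons_add])⟩
    · exact ⟨t, Or.inr (by rw [ht, Multiset.cons_add])⟩
  inj x hx y hy := by
    simpa using h.inj x hx y hy
  mono x hx y hy x' hx' y' hy' hxy hxy' h₁ h₂ h₃ h₄ := by
    simp only [Multiset.card_add, Multiset.sum_add, add_lt_add_iff_right,
      add_le_add_iff_right] at *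
    exact h.mono x hx y hy x' hx' y' hy' hxy hxy' (by omega) (by omega) (by omega) h₄

theorem neg {S : Set α} (h : IsLevelPlanar E S P) :
    IsLevelPlanar E S fun x => (P x).map Neg.neg where
  adj x hx y hy hxy := by
    obtain ⟨t, ht | ht⟩ := h.adj x hx y hy hxy
    · exact ⟨-t, Or.inl (by rw [ht, Multiset.map_cons])⟩
    · exact ⟨-t, Or.inr (by rw [ht, Multiset.map_cons])⟩
  inj x hx y hy := by
    simpa [Multiset.sum_map_neg'] using h.inj x hx y hy
  mono x hx y hy x' hx' y' hy' hxy hxy' h₁ h₂ h₃ h₄ := by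
    simp only [Multiset.card_map, Multiset.sum_map_neg', neg_lt_neg_iff, neg_le_neg_iff] at *
    by_contra! hlt
    rcases lt_trichotomy (P x').sum (P x).sum with h' | h' | h'
    · exact hlt.not_ge (h.mono x' hx' y' hy' x hx y hy hxy' hxy h₂ h₁ h₃.symm h₄)
    · linarith
    · linarith

/-- Two level-planar pieces can be glued if the first lies weakly below the second on each
level. -/
theorem union {A B : Set α} (hA : IsLevelPlanar E A P) (hB : IsLevelPlanar E B P)
    (hsep : ∀ a ∈ A, ∀ b ∈ B, (P a).card = (P b).card →
      (P a).sum < (P b).sum ∨ a = b)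
    (hE : ∀ x y, x ∈ A ∪ B → y ∈ A ∪ B → E x y → (x ∈ A ∧ y ∈ A) ∨ (x ∈ B ∧ y ∈ B)) :
    IsLevelPlanar E (A ∪ B) P where
  adj x hx y hy hxy := by
    rcases hE x y hx hy hxy with h | h
    · exact hA.adj x h.1 y h.2 hxy
    · exact hB.adj x h.1 y h.2 hxy
  inj x hx y hy hc hs := by
    rcases hx with hx | hx <;> rcases hy with hy | hy
    · exact hA.inj x hx y hy hc hs
    · exact (hsep x hx y hy hc).resolve_left hs.not_lt
    · exact ((hsep y hy x hx hc.symm).resolve_left hs.not_gt).symm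
    · exact hB.inj x hx y hy hc hs
  mono x hx y hy x' hx' y' hy' hxy hxy' h₁ h₂ h₃ h₄ := by
    rcases hE x y hx hy hxy with ⟨hx, hy⟩ | ⟨hx, hy⟩ <;>
      rcases hE x' y' hx' hy' hxy' with ⟨hx', hy'⟩ | ⟨hx', hy'⟩
    · exact hA.mono x hx y hy x' hx' y' hy' hxy hxy' h₁ h₂ h₃ h₄
    · rcases hsep y hy y' hy' (by omega) with h | h
      · exact h.le
      · rw [h]
    · rcases hsep x' hx' x hx (by omega) with h | h
      · exact absurd h₄ h.not_gt
      · exact absurd h₄ (by rw [h]; exact lt_irrefl _)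
    · exact hB.mono x hx y hy x' hx' y' hy' hxy hxy' h₁ h₂ h₃ h₄

theorem anti {E' : α → α → Prop} {S : Set α} (h : IsLevelPlanar E S P)
    (hE : ∀ x y, E' x y → E x y) : IsLevelPlanar E' S P where
  adj x hx y hy hxy := h.adj x hx y hy (hE x y hxy)
  inj := h.inj
  mono x hx y hy x' hx' y' hy' hxy hxy' :=
    h.mono x hx y hy x' hx' y' hy' (hE x y hxy) (hE x' y' hxy')

/-- An edge at the only vertex of level zero can be added to a level-planar placement. -/
theorem insert_edge {S : Set α} {p q : α} {t : ℝ}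
    (h : IsLevelPlanar (fun x y => E x y ∧ ¬(x = p ∧ y = q) ∧ ¬(x = q ∧ y = p)) S P)
    (hp : P p = 0) (hq : P q = {t}) (hS : ∀ v ∈ S, v ≠ p → 1 ≤ (P v).card) :
    IsLevelPlanar E S P where
  adj x hx y hy hxy := by
    by_cases h₁ : x = p ∧ y = q
    · exact ⟨t, Or.inl (by rw [h₁.1, h₁.2, hp, hq]; rfl)⟩
    by_cases h₂ : x = q ∧ y = p
    · exact ⟨t, Or.inr (by rw [h₂.1, h₂.2, hp, hq]; rfl)⟩
    exact h.adj x hx y hy ⟨hxy, h₁, h₂⟩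
  inj := h.inj
  mono x hx y hy x' hx' y' hy' hxy hxy' c₁ c₂ c₃ hlt := by
    have hzero : ∀ v ∈ S, (P v).card = 0 → v = p := fun v hv hc =>
      by_contra fun hne => absurd (hS v hv hne) (by omega)
    by_cases h₀ : (P x).card = 0
    · rw [hzero x hx h₀, hzero x' hx' (by omega)] at hlt
      exact absurd hlt (lt_irrefl _)
    have hne : ∀ u v, (P u).card ≠ 0 → (P v).card = (P u).card + 1 →
        ¬(u = p ∧ v = q) ∧ ¬(u = q ∧ v = p) := by
      refine fun u v hu hv => ⟨?_, ?_⟩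
      · rintro ⟨rfl, -⟩
        exact hu (by rw [hp, Multiset.card_zero])
      · rintro ⟨-, rfl⟩
        rw [hp, Multiset.card_zero] at hv
        omega
    exact h.mono x hx y hy x' hx' y' hy' ⟨hxy, hne x y h₀ c₁⟩
      ⟨hxy', hne x' y' (by omega) c₂⟩ c₁ c₂ c₃ hlt

end IsLevelPlanar

/-- Inside an interval of odd length at least three, all edges except possibly the one joining the
endpoints are confined to the three intervals cut out by a quadrilateral. -/
theorem exists_quadrilateral_of_lt {E : ℤ → ℤ → Prop}
    (hodd : ∀ x y, E x y → Odd (y - x)) (hE : NonCrossing E) {p q : ℤ} (hpq : Odd (q - p))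
    (h3 : p + 1 < q) : ∃ r w : ℤ, p < r ∧ r < w ∧ w < q ∧ Odd (r - p) ∧ Odd (w - r) ∧
      Odd (q - w) ∧ ∀ x y, p ≤ x → x < y → y ≤ q → E x y → ¬(x = p ∧ y = q) →
        y ≤ r ∨ (r ≤ x ∧ y ≤ w) ∨ w ≤ x := by
  classical
  obtain ⟨r, hr, hrq, hrmax, hrE⟩ : ∃ r : ℤ, p < r ∧ r < q ∧
      (∀ y, E p y → y < q → y ≤ r) ∧ (E p r ∨ r = p + 1) := by
    have hne : ((Finset.Ioo p q).filter fun y => E p y ∨ y = p + 1).Nonempty :=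
      ⟨p + 1, by simp; omega⟩
    obtain ⟨r, hr, hmax⟩ := Finset.exists_max_image _ id hne
    simp only [Finset.mem_filter, Finset.mem_Ioo, id] at hr hmax
    refine ⟨r, hr.1.1, hr.1.2, fun y hy hyq => ?_, hr.2⟩
    by_cases hpy : p < y
    · exact hmax y ⟨⟨hpy, hyq⟩, Or.inl hy⟩
    · omega
  have hrodd : Odd (r - p) := by
    rcases hrE with h | h
    · exact hodd p r h
    · rw [h]; simp
  have hrq' : r + 1 < q := by
    rw [Int.odd_iff] at *
    omega
  obtain ⟨w, hw, hwq, hwmin, hwE⟩ : ∃ w : ℤ, r < w ∧ w < q ∧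
      (∀ x, E x q → r < x → w ≤ x) ∧ (E w q ∨ w = q - 1) := by
    have hne : ((Finset.Ioo r q).filter fun y => E y q ∨ y = q - 1).Nonempty :=
      ⟨q - 1, by simp; omega⟩
    obtain ⟨w, hw, hmin⟩ := Finset.exists_min_image _ id hne
    simp only [Finset.mem_filter, Finset.mem_Ioo, id] at hw hmin
    refine ⟨w, hw.1.1, hw.1.2, fun x hx hrx => ?_, hw.2⟩
    by_cases hxq : x < q
    · exact hmin x ⟨⟨hrx, hxq⟩, Or.inl hx⟩
    · omega
  have hwodd : Odd (q - w) := by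
    rcases hwE with h | h
    · exact hodd w q h
    · rw [h]; simp
  refine ⟨r, w, hr, hw, hwq, hrodd, ?_, hwodd, fun x y hx hxy hy hExy hne => ?_⟩
  · rw [Int.odd_iff] at *
    omega
  have hxyodd := hodd x y hExy
  rw [Int.odd_iff] at *
  by_contra! hcon
  obtain ⟨c₁, c₂, c₃⟩ := hcon
  rcases lt_or_ge x r with hxr | hxr
  · rcases hx.eq_or_lt with rfl | hx
    · have := hrmax y hExy (by grind)
      omega
    · rcases hrE with h | h
      · exact hE p x r y hx hxr c₁ h hExy
      · omega
  · have c₂ := c₂ hxr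
    rcases hy.eq_or_lt with rfl | hy
    · have := hwmin x hExy
      have : x ≠ r := by rintro rfl; omega
      have : r < x := by omega
      omega
    · rcases hwE with h | h
      · exact hE x w y q c₃ c₂ hy hExy h
      · omega

theorem exists_quadrilateral {E : ℤ → ℤ → Prop} (hsymm : ∀ x y, E x y → E y x)
    (hodd : ∀ x y, E x y → Odd (y - x)) (hE : NonCrossing E) {p q : ℤ} (hpq : Odd (q - p))
    (h3 : 1 < (q - p).natAbs) : ∃ r w : ℤ, (p < r ∧ r < w ∧ w < q ∨ q < w ∧ w < r ∧ r < p) ∧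
      Odd (r - p) ∧ Odd (w - r) ∧ Odd (q - w) ∧
      ∀ x ∈ uIcc p q, ∀ y ∈ uIcc p q, E x y → ¬(x = p ∧ y = q) → ¬(x = q ∧ y = p) →
        (x ∈ uIcc p r ∧ y ∈ uIcc p r) ∨ (x ∈ uIcc r w ∧ y ∈ uIcc r w) ∨
          (x ∈ uIcc q w ∧ y ∈ uIcc q w) := by
  rcases lt_trichotomy p q with h | rfl | h
  · obtain ⟨r, w, h₁, h₂, h₃, o₁, o₂, o₃, hw⟩ :=
      exists_quadrilateral_of_lt hodd hE hpq (by omega)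
    refine ⟨r, w, Or.inl ⟨h₁, h₂, h₃⟩, o₁, o₂, o₃, fun x hx y hy hxy n₁ n₂ => ?_⟩
    simp only [mem_uIcc] at hx hy ⊢
    rcases lt_trichotomy x y with hlt | rfl | hlt
    · have := hw x y (by omega) hlt (by omega) hxy n₁
      omega
    · omega
    · have := hw y x (by omega) hlt (by omega) (hsymm x y hxy) (by tauto)
      omega
  · simp at h3
  · obtain ⟨w, r, h₁, h₂, h₃, o₁, o₂, o₃, hw⟩ := exists_quadrilateral_of_lt hodd hE
      (p := q) (q := p) (by rw [Int.odd_iff] at *; omega) (by omega)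
    refine ⟨r, w, Or.inr ⟨h₁, h₂, h₃⟩, by rw [Int.odd_iff] at *; omega,
      by rw [Int.odd_iff] at *; omega, by rw [Int.odd_iff] at *; omega,
      fun x hx y hy hxy n₁ n₂ => ?_⟩
    simp only [mem_uIcc] at hx hy ⊢
    rcases lt_trichotomy x y with hlt | rfl | hlt
    · have := hw x y (by omega) hlt (by omega) hxy n₂
      omega
    · omega
    · have := hw y x (by omega) hlt (by omega) (hsymm x y hxy) (by tauto)
      omega

/-- The levelwise bounds on the part of a drawing attached above an edge of slope `t`, where `δ` is
the turn of the first rhombus and `η` bounds the later turns. -/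
def LevelBound (t δ η : ℝ) (M : Multiset ℝ) : Prop :=
  1 ≤ M.card ∧ t + (M.card - 1) * (t + δ - 2 * η) ≤ M.sum ∧ M.sum ≤ M.card * (t + δ + 2 * η)

/-- The bounds for the part attached to the bottom side of the first rhombus. -/
def BottomBound (t δ η : ℝ) (M : Multiset ℝ) : Prop :=
  1 ≤ M.card ∧ M.card * (t + δ) + (M.card - 1) * (3 / 5 * η) ≤ M.sum ∧
    M.sum ≤ M.card * (t + δ + 2 * η)

/-- The bounds for the part attached to the opposite side of the first rhombus. -/
def OppositeBound (t δ η : ℝ) (M : Multiset ℝ) : Prop :=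
  2 ≤ M.card ∧ 2 * t + δ + (M.card - 2) * (t + δ - 2 / 5 * η) ≤ M.sum ∧
    M.sum ≤ M.card * (t + δ) + (M.card - 1) * (2 / 5 * η)

/-- The bounds for the part attached to the top side of the first rhombus. -/
def TopBound (t δ η : ℝ) (M : Multiset ℝ) : Prop :=
  2 ≤ M.card ∧ t + (M.card - 1) * (t + δ - 7 / 5 * η) ≤ M.sum ∧
    M.sum ≤ 2 * t + δ + (M.card - 2) * (t + δ - 3 / 5 * η)

section Bounds

variable {t δ η : ℝ} {M N : Multiset ℝ}

theorem levelBound_singleton (hδ : 0 < δ) (hη : 0 < η) : LevelBound t δ η {t} := by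
  simp only [LevelBound, Multiset.card_singleton, Multiset.sum_singleton]
  refine ⟨le_rfl, ?_, ?_⟩ <;> push_cast <;> linarith

theorem levelBound_singleton_add (hδ : 0 < δ) (hη : 0 < η) : LevelBound t δ η {t + δ} := by
  simp only [LevelBound, Multiset.card_singleton, Multiset.sum_singleton]
  refine ⟨le_rfl, ?_, ?_⟩ <;> push_cast <;> linarith

theorem LevelBound.bottom (hη : 0 < η) (h : LevelBound (t + δ) η (η / 5) M) :
    BottomBound t δ η M := by
  obtain ⟨h, h', h''⟩ := h
  have hm : (1 : ℝ) ≤ M.card := by exact_mod_cast h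
  refine ⟨h, ?_, ?_⟩ <;> nlinarith

theorem LevelBound.opposite (h : LevelBound t δ (η / 5) M) :
    OppositeBound t δ η (M + {t + δ}) := by
  obtain ⟨h, h', h''⟩ := h
  have hm : (1 : ℝ) ≤ M.card := by exact_mod_cast h
  rw [OppositeBound, Multiset.card_add, Multiset.card_singleton, Multiset.sum_add,
    Multiset.sum_singleton]
  push_cast
  refine ⟨by omega, ?_, ?_⟩ <;> nlinarith

theorem LevelBound.top (h : LevelBound (-(t + δ)) η (η / 5) M) :
    TopBound t δ η (M.map Neg.neg + {t}) := by
  obtain ⟨h, h', h''⟩ := h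
  have hm : (1 : ℝ) ≤ M.card := by exact_mod_cast h
  rw [TopBound, Multiset.card_add, Multiset.card_singleton, Multiset.sum_add,
    Multiset.sum_singleton, Multiset.card_map, Multiset.sum_map_neg']
  push_cast
  refine ⟨by omega, ?_, ?_⟩ <;> nlinarith

theorem BottomBound.levelBound (hδ : 0 < δ) (hη : 0 < η) (h : BottomBound t δ η M) :
    LevelBound t δ η M := by
  obtain ⟨h, h', h''⟩ := h
  have hm : (1 : ℝ) ≤ M.card := by exact_mod_cast h
  refine ⟨h, ?_, h''⟩
  nlinarith

theorem OppositeBound.levelBound (hη : 0 < η) (h : OppositeBound t δ η M) :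
    LevelBound t δ η M := by
  obtain ⟨h, h', h''⟩ := h
  have hm : (2 : ℝ) ≤ M.card := by exact_mod_cast h
  refine ⟨by omega, ?_, ?_⟩ <;> nlinarith

theorem TopBound.levelBound (hδ : 0 < δ) (hη : 0 < η) (h : TopBound t δ η M) :
    LevelBound t δ η M := by
  obtain ⟨h, h', h''⟩ := h
  have hm : (2 : ℝ) ≤ M.card := by exact_mod_cast h
  refine ⟨by omega, ?_, ?_⟩ <;> nlinarith

theorem TopBound.lt_or_eq_of_opposite (hη : 0 < η) (hM : TopBound t δ η M)
    (hN : OppositeBound t δ η N) (hc : M.card = N.card) :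
    M.sum < N.sum ∨ M.card = 2 ∧ M.sum = 2 * t + δ ∧ N.sum = 2 * t + δ := by
  obtain ⟨h, -, h'⟩ := hM
  obtain ⟨k, k', -⟩ := hN
  rw [← hc] at k'
  rcases h.eq_or_lt with h₂ | h₂
  · rw [← h₂] at h' k'
    norm_num at h' k'
    rcases (h'.trans k').lt_or_eq with hlt | heq
    · exact Or.inl hlt
    · exact Or.inr ⟨h₂.symm, by linarith, by linarith⟩
  · left
    have hm : (2 : ℝ) < M.card := by exact_mod_cast h₂
    nlinarith

theorem TopBound.lt_bottom (hδ : 0 < δ) (hη : 0 < η) (hM : TopBound t δ η M)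
    (hN : BottomBound t δ η N) (hc : M.card = N.card) : M.sum < N.sum := by
  obtain ⟨h, -, h'⟩ := hM
  obtain ⟨k, k', -⟩ := hN
  rw [← hc] at k'
  have hm : (2 : ℝ) ≤ M.card := by exact_mod_cast h
  nlinarith

theorem OppositeBound.lt_bottom (hη : 0 < η) (hM : OppositeBound t δ η M)
    (hN : BottomBound t δ η N) (hc : M.card = N.card) : M.sum < N.sum := by
  obtain ⟨h, -, h'⟩ := hM
  obtain ⟨k, k', -⟩ := hN
  rw [← hc] at k'
  have hm : (2 : ℝ) ≤ M.card := by exact_mod_cast h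
  nlinarith

end Bounds

theorem exists_isLevelPlanar_of_natAbs_le_one {E : ℤ → ℤ → Prop}
    (hodd : ∀ x y, E x y → Odd (y - x)) {p q : ℤ} (hne : q ≠ p) (h1 : (q - p).natAbs ≤ 1)
    (t : ℝ) {δ η : ℝ} (hδ : 0 < δ) (hη : 0 < η) :
    ∃ P : ℤ → Multiset ℝ, P p = 0 ∧ P q = {t} ∧ IsLevelPlanar E (uIcc p q) P ∧
      ∀ v ∈ uIcc p q, v ≠ p → LevelBound t δ η (P v) := by
  classical
  have hmem : ∀ v ∈ uIcc p q, v = p ∨ v = q := fun v hv => by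
    rw [mem_uIcc] at hv
    omega
  have hirr : ∀ x y, E x y → x ≠ y := by
    rintro x _ hxy rfl
    simpa using hodd _ _ hxy
  refine ⟨fun v => if v = p then 0 else {t}, by simp, by simp [hne], ?_, ?_⟩
  · refine IsLevelPlanar.insert_edge (p := p) (q := q) (t := t) ⟨?_, ?_, ?_⟩ (by simp)
      (by simp [hne]) fun v hv hvp => by simp [hvp]
    · rintro x hx y hy ⟨hxy, h₁, h₂⟩
      have := hirr x y hxy
      have := hmem x hx
      have := hmem y hy
      grind
    · intro x hx y hy
      rcases hmem x hx with rfl | rfl <;> rcases hmem y hy with rfl | rfl <;> simp [hne]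
    · rintro x hx y hy x' hx' y' hy' ⟨hxy, h₁, h₂⟩
      have := hirr x y hxy
      have := hmem x hx
      have := hmem y hy
      grind
  · intro v hv hvp
    simp only [hvp, if_false]
    exact levelBound_singleton hδ hη

theorem IsLevelPlanar.of_quadrilateral {α : Type} {E : α → α → Prop} {S₁ S₂ S₃ : Set α}
    {P : α → Multiset ℝ} {p q r w : α} {t δ η : ℝ} (hδ : 0 < δ) (hη : 0 < η)
    (h₁ : IsLevelPlanar E S₁ P) (h₂ : IsLevelPlanar E S₂ P) (h₃ : IsLevelPlanar E S₃ P)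
    (hr₁ : r ∈ S₁) (hw₂ : w ∈ S₂) (hw₃ : w ∈ S₃)
    (hp : P p = 0) (hq : P q = {t}) (hr : P r = {t + δ}) (hw : P w = {t} + {t + δ})
    (b₁ : ∀ v ∈ S₁, v ≠ p → BottomBound t δ η (P v))
    (b₂ : ∀ v ∈ S₂, v ≠ r → OppositeBound t δ η (P v))
    (b₃ : ∀ v ∈ S₃, v ≠ q → TopBound t δ η (P v))
    (hE : ∀ x ∈ (S₃ ∪ S₂) ∪ S₁, ∀ y ∈ (S₃ ∪ S₂) ∪ S₁, E x y → ¬(x = p ∧ y = q) →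
      ¬(x = q ∧ y = p) → (x ∈ S₁ ∧ y ∈ S₁) ∨ (x ∈ S₂ ∧ y ∈ S₂) ∨ (x ∈ S₃ ∧ y ∈ S₃))
    (hS : ∀ x ∈ S₃ ∪ S₂, ∀ y ∈ S₃ ∪ S₂, x ∈ S₁ → y ∈ S₁ → E x y → False) :
    IsLevelPlanar E ((S₃ ∪ S₂) ∪ S₁) P ∧
      ∀ v ∈ (S₃ ∪ S₂) ∪ S₁, v ≠ p → LevelBound t δ η (P v) := by
  have bound : ∀ v ∈ (S₃ ∪ S₂) ∪ S₁, v ≠ p → LevelBound t δ η (P v) := by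
    rintro v ((hv | hv) | hv) hvp
    · by_cases hvq : v = q
      · rw [hvq, hq]
        exact levelBound_singleton hδ hη
      · exact (b₃ v hv hvq).levelBound hδ hη
    · by_cases hvr : v = r
      · rw [hvr, hr]
        exact levelBound_singleton_add hδ hη
      · exact (b₂ v hv hvr).levelBound hη
    · exact (b₁ v hv hvp).levelBound hδ hη
  refine ⟨insert_edge ?_ hp hq fun v hv hvp => (bound v hv hvp).1, bound⟩
  have hsub : ∀ x y, (E x y ∧ ¬(x = p ∧ y = q) ∧ ¬(x = q ∧ y = p)) → E x y := fun x y h => h.1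
  have hwc : (P w).card = 2 := by simp [hw]
  have hws : (P w).sum = 2 * t + δ := by
    simp only [hw, Multiset.sum_add, Multiset.sum_singleton]
    ring
  refine ((h₃.anti hsub).union (h₂.anti hsub) ?_ ?_).union (h₁.anti hsub) ?_ ?_
  · intro a ha b hb hc
    by_cases haq : a = q <;> by_cases hbr : b = r
    · left
      rw [haq, hbr, hq, hr, Multiset.sum_singleton, Multiset.sum_singleton]
      linarith
    · have := (b₂ b hb hbr).1
      rw [haq, hq, Multiset.card_singleton] at hc
      omega
    · have := (b₃ a ha haq).1
      rw [hbr, hr, Multiset.card_singleton] at hc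
      omega
    · rcases (b₃ a ha haq).lt_or_eq_of_opposite hη (b₂ b hb hbr) hc with h | ⟨k, k₁, k₂⟩
      · exact Or.inl h
      · right
        rw [h₃.inj a ha w hw₃ (by omega) (by linarith),
          h₂.inj b hb w hw₂ (by omega) (by linarith)]
  · rintro x y hx hy ⟨hxy, n₁, n₂⟩
    rcases hE x (Or.inl hx) y (Or.inl hy) hxy n₁ n₂ with h | h | h
    · exact (hS x hx y hy h.1 h.2 hxy).elim
    · exact Or.inr h
    · exact Or.inl h
  · intro a ha b hb hc
    by_cases hbp : b = p
    · rw [hbp, hp, Multiset.card_zero] at hc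
      rcases ha with ha | ha
      · by_cases haq : a = q
        · simp [haq, hq] at hc
        · have := (b₃ a ha haq).1
          omega
      · by_cases har : a = r
        · simp [har, hr] at hc
        · have := (b₂ a ha har).1
          omega
    have hb' := b₁ b hb hbp
    have one : (P b).card = 1 → t + δ ≤ (P b).sum := by
      intro h
      have := hb'.2.1
      rw [h] at this
      norm_num at this
      exact this
    rcases ha with ha | ha
    · left
      by_cases haq : a = q
      · rw [haq, hq, Multiset.card_singleton] at hc
        have := one hc.symm
        rw [haq, hq, Multiset.sum_singleton]
        linarith
      · exact (b₃ a ha haq).lt_bottom hδ hη hb' hc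
    · by_cases har : a = r
      · rw [har, hr, Multiset.card_singleton] at hc
        have := one hc.symm
        rw [har]
        rcases this.lt_or_eq with hlt | heq
        · left
          rwa [hr, Multiset.sum_singleton]
        · right
          refine h₁.inj r hr₁ b hb ?_ ?_
          · rw [hr, Multiset.card_singleton, hc]
          · rw [hr, Multiset.sum_singleton, heq]
      · exact Or.inl ((b₂ a ha har).lt_bottom hη hb' hc)
  · rintro x y hx hy ⟨hxy, n₁, n₂⟩
    rcases hE x hx y hy hxy n₁ n₂ with h | h | h
    · exact Or.inr h
    · exact Or.inl ⟨Or.inr h.1, Or.inr h.2⟩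
    · exact Or.inl ⟨Or.inl h.1, Or.inl h.2⟩

theorem exists_isLevelPlanar {E : ℤ → ℤ → Prop} (hsymm : ∀ x y, E x y → E y x)
    (hodd : ∀ x y, E x y → Odd (y - x)) (hE : NonCrossing E) (n : ℕ) :
    ∀ p q : ℤ, (q - p).natAbs = n → Odd (q - p) → ∀ t δ η : ℝ, 0 < δ → 0 < η →
      ∃ P : ℤ → Multiset ℝ, P p = 0 ∧ P q = {t} ∧ IsLevelPlanar E (uIcc p q) P ∧
        ∀ v ∈ uIcc p q, v ≠ p → LevelBound t δ η (P v) := by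
  classical
  induction n using Nat.strong_induction_on with
  | _ n ih =>
  intro p q hn hpq t δ η hδ hη
  have hne : q ≠ p := by
    rintro rfl
    simp at hpq
  rcases le_or_gt (q - p).natAbs 1 with h1 | h1
  · exact exists_isLevelPlanar_of_natAbs_le_one hodd hne h1 t hδ hη
  obtain ⟨r, w, hord, o₁, o₂, o₃, hquad⟩ := exists_quadrilateral hsymm hodd hE hpq h1
  obtain ⟨P₁, hp₁, hr₁, hP₁, hb₁⟩ := ih (r - p).natAbs (by omega) p r rfl o₁ (t + δ) η (η / 5)
    hη (by positivity)
  obtain ⟨P₂, hr₂, hw₂, hP₂, hb₂⟩ := ih (w - r).natAbs (by omega) r w rfl o₂ t δ (η / 5)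
    hδ (by positivity)
  obtain ⟨P₃, hq₃, hw₃, hP₃, hb₃⟩ := ih (w - q).natAbs (by omega) q w rfl
    (by rw [Int.odd_iff] at *; omega) (-(t + δ)) η (η / 5) hη (by positivity)
  obtain ⟨P, e₁, e₂, e₃⟩ : ∃ P : ℤ → Multiset ℝ, (∀ v ∈ uIcc p r, P v = P₁ v) ∧
      (∀ v ∈ uIcc r w, P v = P₂ v + {t + δ}) ∧
      ∀ v ∈ uIcc q w, P v = (P₃ v).map Neg.neg + {t} := by
    refine ⟨fun v => if v ∈ uIcc p r then P₁ v else
      if v ∈ uIcc r w then P₂ v + {t + δ} else (P₃ v).map Neg.neg + {t},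
      fun v hv => if_pos hv, fun v hv => ?_, fun v hv => ?_⟩
    · by_cases h : v ∈ uIcc p r
      · have : v = r := by
          rw [mem_uIcc] at h hv
          omega
        simp only [if_pos h]
        rw [this, hr₁, hr₂, zero_add]
      · simp only [if_neg h, if_pos hv]
    · have h : v ∉ uIcc p r := by
        rw [mem_uIcc] at hv ⊢
        omega
      by_cases h' : v ∈ uIcc r w
      · have : v = w := by
          rw [mem_uIcc] at h' hv
          omega
        simp only [if_neg h, if_pos h']
        rw [this, hw₂, hw₃, Multiset.map_singleton, neg_neg, add_comm]
      · simp only [if_neg h, if_neg h']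
  have hp : P p = 0 := by rw [e₁ p left_mem_uIcc, hp₁]
  have hq : P q = {t} := by rw [e₃ q left_mem_uIcc, hq₃, Multiset.map_zero, zero_add]
  have hunion : uIcc p q = (uIcc q w ∪ uIcc r w) ∪ uIcc p r := by
    ext v
    simp only [mem_union, mem_uIcc]
    omega
  have key := IsLevelPlanar.of_quadrilateral hδ hη (hP₁.congr e₁) ((hP₂.add {t + δ}).congr e₂)
    ((hP₃.neg.add {t}).congr e₃) (p := p) (q := q) (r := r) (w := w)
    right_mem_uIcc right_mem_uIcc right_mem_uIcc hp hq (by rw [e₁ r right_mem_uIcc, hr₁])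
    (by rw [e₂ w right_mem_uIcc, hw₂])
    (fun v hv hvp => e₁ v hv ▸ (hb₁ v hv hvp).bottom hη)
    (fun v hv hvr => e₂ v hv ▸ (hb₂ v hv hvr).opposite)
    (fun v hv hvq => e₃ v hv ▸ (hb₃ v hv hvq).top)
    (hunion ▸ hquad)
    (by
      intro x hx y hy hx' hy' hxy
      have hr : ∀ z, z ∈ uIcc q w ∪ uIcc r w → z ∈ uIcc p r → z = r := by
        intro z hz hz'
        simp only [mem_union, mem_uIcc] at hz hz'
        omega
      have := hodd x y hxy
      rw [hr x hx hx', hr y hy hy'] at this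
      simp at this)
  rw [← hunion] at key
  exact ⟨P, hp, hq, key.1, key.2⟩

/-- Twice the signed area of a triangle in the plane. -/
def signedArea (A B C : Plane) : ℝ := (B 0 - A 0) * (C 1 - A 1) - (B 1 - A 1) * (C 0 - A 0)

theorem segment_inter_segment_nonempty {A B C D : Plane} (h₁ : 0 < signedArea A B C)
    (h₂ : 0 < signedArea A B D) (h₃ : 0 < signedArea A C D) (h₄ : 0 < signedArea B C D) :
    (segment ℝ A C ∩ segment ℝ B D).Nonempty := by
  have hT : signedArea B C D + signedArea A B D = signedArea A C D + signedArea A B C := by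
    simp only [signedArea]
    ring
  have pos : 0 < signedArea B C D + signedArea A B D := by positivity
  refine ⟨(signedArea B C D / (signedArea B C D + signedArea A B D)) • A +
    (signedArea A B D / (signedArea B C D + signedArea A B D)) • C,
    ⟨_, _, by positivity, by positivity, by field_simp, rfl⟩,
    ⟨signedArea A C D / (signedArea B C D + signedArea A B D),
      signedArea A B C / (signedArea B C D + signedArea A B D), by positivity, by positivity,
      by rw [← add_div, ← hT, div_self pos.ne'], ?_⟩⟩
  ext i
  simp only [PiLp.add_apply, PiLp.smul_apply, smul_eq_mul]
  field_simp
  fin_cases i <;> simp [signedArea] <;> ring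

theorem sin_add_sin_sub_sin_pos {a b c : ℝ} (hab : a < b) (hbc : b < c)
    (hca : c < a + 2 * Real.pi) :
    0 < Real.sin (b - a) + Real.sin (c - b) - Real.sin (c - a) := by
  have key : ∀ u v : ℝ, Real.sin (2 * u) + Real.sin (2 * v) - Real.sin (2 * u + 2 * v) =
      4 * Real.sin u * Real.sin v * Real.sin (u + v) := by
    intro u v
    rw [Real.sin_add (2 * u), Real.sin_add u, Real.sin_two_mul, Real.sin_two_mul,
      Real.cos_two_mul', Real.cos_two_mul']
    have hu := Real.sin_sq_add_cos_sq u
    have hv := Real.sin_sq_add_cos_sq v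
    linear_combination
      (-2 * Real.sin u * Real.cos u) * hv + (-2 * Real.sin v * Real.cos v) * hu
  have h := key ((b - a) / 2) ((c - b) / 2)
  rw [show 2 * ((b - a) / 2) + 2 * ((c - b) / 2) = c - a by ring,
    mul_div_cancel₀ _ two_ne_zero, mul_div_cancel₀ _ two_ne_zero] at h
  rw [h]
  have h₁ := Real.sin_pos_of_pos_of_lt_pi (x := (b - a) / 2) (by linarith) (by linarith)
  have h₂ := Real.sin_pos_of_pos_of_lt_pi (x := (c - b) / 2) (by linarith) (by linarith)
  have h₃ := Real.sin_pos_of_pos_of_lt_pi (x := (b - a) / 2 + (c - b) / 2)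
    (by linarith) (by linarith)
  positivity

theorem signedArea_circle_pos {A B C O : Plane} {r a b c : ℝ} (hr : r ≠ 0)
    (hA : A 0 = O 0 + r * Real.cos a ∧ A 1 = O 1 + r * Real.sin a)
    (hB : B 0 = O 0 + r * Real.cos b ∧ B 1 = O 1 + r * Real.sin b)
    (hC : C 0 = O 0 + r * Real.cos c ∧ C 1 = O 1 + r * Real.sin c)
    (hab : a < b) (hbc : b < c) (hca : c < a + 2 * Real.pi) : 0 < signedArea A B C := by
  have : signedArea A B C =
      r ^ 2 * (Real.sin (b - a) + Real.sin (c - b) - Real.sin (c - a)) := by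
    rw [signedArea, hA.1, hA.2, hB.1, hB.2, hC.1, hC.2, Real.sin_sub, Real.sin_sub, Real.sin_sub]
    ring
  rw [this]
  have := sin_add_sin_sub_sin_pos hab hbc hca
  positivity

theorem exists_angle_of_dist_eq {A O : Plane} {r : ℝ} (h : dist A O = r) :
    ∃ a : ℝ, -Real.pi < a ∧ a ≤ Real.pi ∧
      A 0 = O 0 + r * Real.cos a ∧ A 1 = O 1 + r * Real.sin a := by
  set z : ℂ := ⟨A 0 - O 0, A 1 - O 1⟩ with hz
  have hr : ‖z‖ = r := by
    rw [← h, EuclideanSpace.dist_eq, Complex.norm_def, Complex.normSq_apply, Fin.sum_univ_two,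
      Real.dist_eq, Real.dist_eq, sq_abs, sq_abs, sq, sq]
  refine ⟨z.arg, Complex.neg_pi_lt_arg z, Complex.arg_le_pi z, ?_, ?_⟩
  · rw [← hr, Complex.norm_mul_cos_arg]
    simp [hz]
  · rw [← hr, Complex.norm_mul_sin_arg]
    simp [hz]

/-- The vertices of an outerplanar graph can be put on a line such that no two edges, drawn as arcs
in the upper half-plane, cross. -/
theorem IsOuterplanar.exists_order {V : Type} {G : SimpleGraph V} (h : IsOuterplanar G) :
    ∃ g : V → ℝ, Function.Injective g ∧ ∀ a b c d : V, g a < g b → g b < g c → g c < g d →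
      G.Adj a c → G.Adj b d → False := by
  obtain ⟨ρ, O, r, ⟨hinj, -, hedge⟩, hcirc⟩ := h
  choose g hg hg' hcos hsin using fun v => exists_angle_of_dist_eq (hcirc v)
  have ginj : Function.Injective g := by
    intro u v huv
    apply hinj
    ext i
    fin_cases i
    · simp only [Fin.zero_eta]
      rw [hcos u, hcos v, huv]
    · simp only [Fin.mk_one]
      rw [hsin u, hsin v, huv]
  refine ⟨g, ginj, fun a b c d hab hbc hcd hac hbd => ?_⟩
  have hr : r ≠ 0 := by
    rintro rfl
    have := hinj ((dist_eq_zero.1 (hcirc a)).trans (dist_eq_zero.1 (hcirc b)).symm)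
    exact hab.ne (by rw [this])
  have area : ∀ x y z, g x < g y → g y < g z → 0 < signedArea (ρ x) (ρ y) (ρ z) :=
    fun x y z hxy hyz => signedArea_circle_pos hr ⟨hcos x, hsin x⟩ ⟨hcos y, hsin y⟩
      ⟨hcos z, hsin z⟩ hxy hyz (by linarith [hg x, hg' z])
  obtain ⟨z, hz⟩ := segment_inter_segment_nonempty (area a b c hab hbc)
    (area a b d hab (hbc.trans hcd)) (area a c d (hab.trans hbc) hcd) (area b c d hbc hcd)
  have ne : ∀ x y, g x < g y → x ≠ y := fun x y hxy he => hxy.ne (by rw [he])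
  have nab := ne a b hab
  have nad := ne a d (hab.trans (hbc.trans hcd))
  rw [hedge a c b d hac hbd (by rw [ne_eq, Sym2.eq_iff]; tauto)] at hz
  obtain ⟨w, hw, hw', -⟩ := hz
  have nbc := ne b c hbc
  have ncd := ne c d hcd
  grind

/-- The vertices of a bipartite outerplanar graph can be put at integer points such that, moreover,
adjacent vertices have different parity. -/
theorem IsOuterplanar.exists_int_order {V : Type} [Fintype V] {G : SimpleGraph V}
    (hbip : G.Colorable 2) (h : IsOuterplanar G) :
    ∃ f : V → ℤ, Function.Injective f ∧ (∀ v, 0 ≤ f v) ∧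
      (∀ u v, G.Adj u v → Odd (f v - f u)) ∧
      ∀ a b c d : V, f a < f b → f b < f c → f c < f d → G.Adj a c → G.Adj b d → False := by
  classical
  obtain ⟨g, ginj, hg⟩ := h.exists_order
  obtain ⟨C⟩ := hbip
  set k : V → ℕ := fun v => (Finset.univ.filter fun u => g u < g v).card with hk
  have kmono : ∀ u v, g u < g v → k u < k v := by
    intro u v huv
    refine Finset.card_lt_card (Finset.ssubset_iff_of_subset ?_ |>.2 ⟨u, ?_, ?_⟩)
    · intro x hx
      simp only [Finset.mem_filter, Finset.mem_univ, true_and] at hx ⊢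
      exact hx.trans huv
    · simpa using huv
    · simp
  set f : V → ℤ := fun v => 2 * k v + (C v : ℕ) with hf
  have fmono : ∀ u v, g u < g v → f u < f v := by
    intro u v huv
    have := kmono u v huv
    have := (C u).isLt
    have := (C v).isLt
    simp only [hf]
    omega
  have glt : ∀ u v, f u < f v → g u < g v := by
    intro u v huv
    rcases lt_trichotomy (g u) (g v) with hlt | heq | hlt
    · exact hlt
    · rw [ginj heq] at huv
      exact absurd huv (lt_irrefl _)
    · exact absurd huv (fmono v u hlt).not_gt
  refine ⟨f, ?_, fun v => by simp only [hf]; positivity, ?_,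
    fun a b c d hab hbc hcd => hg a b c d (glt a b hab) (glt b c hbc) (glt c d hcd)⟩
  · intro u v huv
    by_contra hne
    rcases (ginj.ne hne).lt_or_gt with hlt | hlt
    · exact (fmono u v hlt).ne huv
    · exact (fmono v u hlt).ne' huv
  · intro u v huv
    have hne : (C u : ℕ) ≠ C v := fun he => C.valid huv (Fin.ext he)
    have := (C u).isLt
    have := (C v).isLt
    simp only [hf, Int.odd_iff]
    omega

theorem exists_unit_drawing_of_outerplanar {V : Type} [Fintype V] {G : SimpleGraph V}
    (hbip : G.Colorable 2) (houter : IsOuterplanar G) :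
    ∃ ρ : V → Plane, IsPlanarDrawing G ρ ∧ ∀ u v : V, G.Adj u v → dist (ρ u) (ρ v) = 1 := by
  obtain ⟨f, finj, fnonneg, fodd, fcross⟩ := houter.exists_int_order hbip
  obtain ⟨N, hN⟩ := (Set.finite_range f).bddAbove
  set E : ℤ → ℤ → Prop := fun x y => ∃ u v, G.Adj u v ∧ f u = x ∧ f v = y
  have hsymm : ∀ x y, E x y → E y x := fun x y ⟨u, v, h, hu, hv⟩ => ⟨v, u, h.symm, hv, hu⟩
  have hodd : ∀ x y, E x y → Odd (y - x) := by
    rintro x y ⟨u, v, h, rfl, rfl⟩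
    exact fodd u v h
  have hE : NonCrossing E := by
    rintro a b c d hab hbc hcd ⟨u, v, h, rfl, rfl⟩ ⟨x, y, h', rfl, rfl⟩
    exact fcross u x v y hab hbc hcd h h'
  obtain ⟨P, -, -, hP, -⟩ := exists_isLevelPlanar hsymm hodd hE _ 0 (2 * |N| + 1) rfl
    (by simp [parity_simps]) 0 1 1 one_pos one_pos
  have hmem : ∀ v, f v ∈ uIcc 0 (2 * |N| + 1) := by
    intro v
    have h₁ := hN (Set.mem_range_self v)
    have h₂ := fnonneg v
    have h₃ := le_abs_self N
    rw [mem_uIcc]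
    omega
  refine IsLevelPlanar.exists_unit_drawing (P := fun v => P (f v)) ⟨?_, ?_, ?_⟩
  · intro x _ y _ hxy
    exact hP.adj _ (hmem x) _ (hmem y) ⟨x, y, hxy, rfl, rfl⟩
  · intro x _ y _ hc hs
    exact finj (hP.inj _ (hmem x) _ (hmem y) hc hs)
  · intro x _ y _ x' _ y' _ hxy hxy'
    exact hP.mono _ (hmem x) _ (hmem y) _ (hmem x') _ (hmem y') ⟨x, y, hxy, rfl, rfl⟩
      ⟨x', y', hxy', rfl, rfl⟩

theorem one_le_edgeLengthRatio {V : Type} [Finite V] {G : SimpleGraph V} {ρ : V → Plane}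
    (hρ : Function.Injective ρ) (hne : ∃ u v : V, G.Adj u v) : 1 ≤ edgeLengthRatio G ρ := by
  set D : Set ℝ := {d : ℝ | ∃ u v : V, G.Adj u v ∧ d = dist (ρ u) (ρ v)} with hD
  have hfin : D.Finite := by
    refine (Set.finite_range fun p : V × V => dist (ρ p.1) (ρ p.2)).subset ?_
    rintro d ⟨u, v, -, rfl⟩
    exact ⟨(u, v), rfl⟩
  have hDne : D.Nonempty := by
    obtain ⟨u, v, huv⟩ := hne
    exact ⟨_, u, v, huv, rfl⟩
  have hpos : 0 < sInf D := by
    obtain ⟨u, v, huv, h⟩ := hDne.csInf_mem hfin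
    rw [h]
    exact dist_pos.2 (hρ.ne huv.ne)
  rw [edgeLengthRatio, one_le_div hpos]
  exact csInf_le_csSup hDne hfin.bddBelow hfin.bddAbove

theorem edgeLengthRatio_eq_one {V : Type} {G : SimpleGraph V} {ρ : V → Plane}
    (h : ∀ u v : V, G.Adj u v → dist (ρ u) (ρ v) = 1) (hne : ∃ u v : V, G.Adj u v) :
    edgeLengthRatio G ρ = 1 := by
  have : {d : ℝ | ∃ u v : V, G.Adj u v ∧ d = dist (ρ u) (ρ v)} = {1} := by
    ext d
    constructor
    · rintro ⟨u, v, huv, rfl⟩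
      exact h u v huv
    · rintro rfl
      obtain ⟨u, v, huv⟩ := hne
      exact ⟨u, v, huv, (h u v huv).symm⟩
  rw [edgeLengthRatio, this, csSup_singleton, csInf_singleton, div_one]

/-- Every bipartite outerplanar finite simple graph admits a planar
straight-line drawing with all edges of length exactly 1; in particular, if it has at
least one edge, its planar edge-length ratio equals 1. -/
theorem bipartite_outerplanar_unit_drawing {V : Type} [Fintype V] (G : SimpleGraph V)
    (hbip : G.Colorable 2) (houter : IsOuterplanar G) :
    (∃ ρ : V → Plane, IsPlanarDrawing G ρ ∧
      ∀ u v : V, G.Adj u v → dist (ρ u) (ρ v) = 1) ∧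
    ((∃ u v : V, G.Adj u v) → planarEdgeLengthRatio G = 1) := by
  obtain ⟨ρ, hρ, hdist⟩ := exists_unit_drawing_of_outerplanar hbip houter
  refine ⟨⟨ρ, hρ, hdist⟩, fun hne => le_antisymm ?_ ?_⟩
  · refine csInf_le ⟨1, ?_⟩ ⟨ρ, hρ, (edgeLengthRatio_eq_one hdist hne).symm⟩
    rintro r ⟨ρ', hρ', rfl⟩
    exact one_le_edgeLengthRatio hρ'.1 hne
  · refine le_csInf ⟨_, ρ, hρ, rfl⟩ ?_
    rintro r ⟨ρ', hρ', rfl⟩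
    exact one_le_edgeLengthRatio hρ'.1 hne
end
end

section
/- For every real number k ≥ 1 there exists an integer n ≥ 1 such that every nested planar straight-line drawing of the graph G_n has edge-length ratio at least k. -/
noncomputable section

/-- Vertices of the graph `G_n`: the three roots `r₀, r₁, r₂` (`Sum.inl i` for
`i : Fin 3`) together with a vertex `v_σ` for every nonempty binary string `σ` of length
at most `n`. A binary string is encoded as a `List Bool` whose head is the *last*
character of the string (so appending a character `c` to `σ` is `c :: σ`), with
`0 = false` and `1 = true`. -/
abbrev NVert (n : ℕ) : Type := Fin 3 ⊕ {l : List Bool // l ≠ [] ∧ l.length ≤ n}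

/-- The parent pair `p(σ)` of a nonempty binary string `σ` (vertices are encoded in
`Fin 3 ⊕ List Bool`, `Sum.inl i` being the root `rᵢ` and `Sum.inr τ` being `v_τ`):
`p(⟨0⟩) = (r₀, r₂)`, `p(⟨1⟩) = (r₁, r₂)`, and if `p(τ) = (x, y)` then
`p(τ⌢0) = (v_τ, x)` and `p(τ⌢1) = (v_τ, y)`.  (The value on `[]` is junk.) -/
def parentPair : List Bool → (Fin 3 ⊕ List Bool) × (Fin 3 ⊕ List Bool)
  | [] => (Sum.inl 0, Sum.inl 0)
  | [false] => (Sum.inl 0, Sum.inl 2)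
  | [true] => (Sum.inl 1, Sum.inl 2)
  | c :: d :: τ =>
      (Sum.inr (d :: τ), if c then (parentPair (d :: τ)).2 else (parentPair (d :: τ)).1)

/-- The inclusion of the vertices of `G_n` into `Fin 3 ⊕ List Bool`. -/
def nVertIncl {n : ℕ} : NVert n → Fin 3 ⊕ List Bool
  | Sum.inl i => Sum.inl i
  | Sum.inr l => Sum.inr l.1

/-- The graph `G_n`: the three roots are pairwise adjacent, and every vertex `v_σ`
(for a nonempty binary string `σ` with `|σ| ≤ n`) is adjacent to both components of its
parent pair `p(σ)`. -/
def nestedGraph (n : ℕ) : SimpleGraph (NVert n) :=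
  SimpleGraph.fromRel fun a b =>
    (∃ i j : Fin 3, a = Sum.inl i ∧ b = Sum.inl j) ∨
    (∃ σ : {l : List Bool // l ≠ [] ∧ l.length ≤ n}, b = Sum.inr σ ∧
      (nVertIncl a = (parentPair σ.1).1 ∨ nVertIncl a = (parentPair σ.1).2))

/-- Extension of a drawing of `G_n` to all of `Fin 3 ⊕ List Bool` (junk value `0` on
strings that are not vertices of `G_n`). -/
def liftDraw (n : ℕ) (ρ : NVert n → Plane) : Fin 3 ⊕ List Bool → Plane
  | Sum.inl i => ρ (Sum.inl i)
  | Sum.inr l => if h : l ≠ [] ∧ l.length ≤ n then ρ (Sum.inr ⟨l, h⟩) else 0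

/-- A nested (embedding-preserving) planar straight-line drawing of `G_n`: `v_⟨0⟩` and
`v_⟨1⟩` are drawn in the interior of the triangle of the roots, and each `v_{τ⌢c}` is
drawn in the interior of the triangle with vertices `v_τ`, `x_τ`, `y_τ`, where
`p(τ) = (x_τ, y_τ)`. -/
def IsNestedDrawing (n : ℕ) (ρ : NVert n → Plane) : Prop :=
  IsPlanarDrawing (nestedGraph n) ρ ∧
  (∀ (c : Bool) (h : ([c] : List Bool) ≠ [] ∧ ([c] : List Bool).length ≤ n),
    ρ (Sum.inr ⟨[c], h⟩) ∈
      interior (convexHull ℝ {ρ (Sum.inl 0), ρ (Sum.inl 1), ρ (Sum.inl 2)})) ∧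
  (∀ (τ : List Bool) (c : Bool) (hτ : τ ≠ []) (hlen : τ.length + 1 ≤ n)
      (h : (c :: τ : List Bool) ≠ [] ∧ (c :: τ : List Bool).length ≤ n),
    ρ (Sum.inr ⟨c :: τ, h⟩) ∈
      interior (convexHull ℝ
        {liftDraw n ρ (Sum.inr τ), liftDraw n ρ (parentPair τ).1,
         liftDraw n ρ (parentPair τ).2}))

section NonCrossing

variable {E : Type*} [AddCommGroup E] [Module ℝ E] {v x y w u : E} {b c b' c' : ℝ}

/-- In a triangle `v x y`, if no two of the three pairs of opposite edges among the stars of the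
interior points `w` (joined to `v`, `x`) and `u` (joined to `v`, `y`) cross, then `w` is seen from
`v` on the same side of `u` as `x`. -/
lemma mul_le_mul_of_segments_disjoint
    (hw : w = (1 - b - c) • v + b • x + c • y) (hu : u = (1 - b' - c') • v + b' • x + c' • y)
    (hb : 0 < b) (hc : 0 < c) (hbc : b + c < 1) (hb' : 0 < b') (hc' : 0 < c') (hbc' : b' + c' < 1)
    (h₁ : Disjoint (segment ℝ v u) (segment ℝ x w))
    (h₂ : Disjoint (segment ℝ v w) (segment ℝ y u))
    (h₃ : Disjoint (segment ℝ x w) (segment ℝ y u)) :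
    b' * c ≤ c' * b := by
  by_contra! h
  subst hw hu
  by_cases hi : c * (1 - b') ≤ c' * (1 - b)
  · have hD : 0 < b' * c + c' * (1 - b) := by nlinarith [mul_pos hb' hc]
    refine Set.disjoint_left.1 h₁
      ⟨1 - c / (b' * c + c' * (1 - b)), c / (b' * c + c' * (1 - b)), ?_, by positivity, by ring, rfl⟩
      ⟨1 - c' / (b' * c + c' * (1 - b)), c' / (b' * c + c' * (1 - b)), ?_, by positivity, by ring, ?_⟩
    · rw [sub_nonneg, div_le_one hD]; linarith
    · rw [sub_nonneg, div_le_one hD]; linarith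
    · match_scalars <;> field_simp <;> ring
  by_cases hii : b' * (1 - c) ≤ b * (1 - c')
  · have hD : 0 < b' * c + b * (1 - c') := by nlinarith [mul_pos hb' hc]
    refine Set.disjoint_left.1 h₂
      ⟨1 - b' / (b' * c + b * (1 - c')), b' / (b' * c + b * (1 - c')), ?_, by positivity, by ring, rfl⟩
      ⟨1 - b / (b' * c + b * (1 - c')), b / (b' * c + b * (1 - c')), ?_, by positivity, by ring, ?_⟩
    · rw [sub_nonneg, div_le_one hD]; linarith
    · rw [sub_nonneg, div_le_one hD]; linarith
    · match_scalars <;> field_simp <;> ring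
  obtain ⟨D, hDe⟩ : ∃ D, D = (1 - b) * (1 - c') - b' * c := ⟨_, rfl⟩
  have hD : 0 < D := by nlinarith
  have e₁ : 0 ≤ 1 - c' - b' := by linarith
  have e₂ : 0 ≤ 1 - b - c := by linarith
  refine Set.disjoint_left.1 h₃
    ⟨1 - (1 - c' - b') / D, (1 - c' - b') / D, ?_, by positivity, by ring, rfl⟩
    ⟨1 - (1 - b - c) / D, (1 - b - c) / D, ?_, by positivity, by ring, ?_⟩
  · rw [sub_nonneg, div_le_one hD]; linarith
  · rw [sub_nonneg, div_le_one hD]; linarith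
  · match_scalars <;> field_simp <;> (try rw [hDe]) <;> ring

/-- A point of a triangle lying on none of its sides has positive barycentric coordinates. -/
lemma exists_pos_of_mem_convexHull (h : w ∈ convexHull ℝ {v, x, y})
    (hx : w ∉ segment ℝ v x) (hy : w ∉ segment ℝ v y) (hxy : w ∉ segment ℝ x y) :
    ∃ b c : ℝ, 0 < b ∧ 0 < c ∧ b + c < 1 ∧ w = (1 - b - c) • v + b • x + c • y := by
  rw [convexHull_insert (by simp), convexHull_pair, mem_convexJoin] at h
  obtain ⟨p, rfl, q, ⟨s, t, hs, ht, hst, rfl⟩, r, l, hr, hl, hrl, rfl⟩ := h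
  obtain rfl : r = 1 - l := by linarith
  obtain rfl : s = 1 - t := by linarith
  have hl0 : 0 < l := hl.lt_of_ne' fun h => hx ⟨1, 0, by simp, by simp, by simp, by simp [h]⟩
  have ht0 : 0 < t := ht.lt_of_ne' fun h => hx ⟨1 - l, l, hr, hl, hrl, by simp [h]⟩
  have hs0 : 0 < 1 - t := hs.lt_of_ne' fun h =>
    hy ⟨1 - l, l, hr, hl, hrl, by simp [show t = 1 by linarith]⟩
  have hr0 : 0 < 1 - l := hr.lt_of_ne' fun h =>
    hxy ⟨1 - t, t, hs, ht, hst, by simp [show l = 1 by linarith]⟩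
  exact ⟨l * (1 - t), l * t, by positivity, by positivity, by linarith, by module⟩

end NonCrossing

/-- The three sides of a triangle have length between `m` and `M`. -/
def SidesIn (m M : ℝ) (v x y : Plane) : Prop :=
  dist v x ∈ Set.Icc m M ∧ dist v y ∈ Set.Icc m M ∧ dist x y ∈ Set.Icc m M

/-- Binary trees of depth `n` of nested triangles rooted at the triangle with apex `v` and base
`x y`, all of whose sides have length between `m` and `M`. -/
def NestedTree (m M : ℝ) : ℕ → Plane → Plane → Plane → Prop
  | 0, v, x, y => SidesIn m M v x y
  | n + 1, v, x, y => SidesIn m M v x y ∧ ∃ (w u : Plane) (b c b' c' : ℝ),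
      w = (1 - b - c) • v + b • x + c • y ∧ u = (1 - b' - c') • v + b' • x + c' • y ∧
      0 < b ∧ 0 < c ∧ b + c < 1 ∧ 0 < b' ∧ 0 < c' ∧ b' + c' < 1 ∧ b' * c ≤ c' * b ∧
      NestedTree m M n w v x ∧ NestedTree m M n u v y

lemma NestedTree.sidesIn {m M : ℝ} {n : ℕ} {v x y : Plane} (h : NestedTree m M n v x y) :
    SidesIn m M v x y := by
  cases n with
  | zero => exact h
  | succ n => exact h.1

/-- Twice the signed area of a triangle. -/
def cross (p q r : Plane) : ℝ := (q 0 - p 0) * (r 1 - p 1) - (q 1 - p 1) * (r 0 - p 0)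

/-- Some triangle at depth `j` has at most `2⁻ʲ` times the area of the root triangle. -/
lemma NestedTree.exists_small {m M : ℝ} {n : ℕ} (j : ℕ) {v x y : Plane}
    (h : NestedTree m M (n + j) v x y) :
    ∃ v' x' y', NestedTree m M n v' x' y' ∧ |cross v' x' y'| ≤ |cross v x y| / 2 ^ j := by
  induction j generalizing v x y with
  | zero => exact ⟨v, x, y, h, by simp⟩
  | succ j ih =>
    obtain ⟨-, w, u, b, c, b', c', hw, hu, hb, hc, hbc, hb', hc', hbc', hle, hT₀, hT₁⟩ := h
    have hsum : c + b' ≤ 1 := by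
      by_contra! hlt
      nlinarith
    rcases le_total c (1 / 2) with hc2 | hc2
    · obtain ⟨v', x', y', hT, hle'⟩ := ih hT₀
      refine ⟨v', x', y', hT, hle'.trans ?_⟩
      have : cross w v x = c * cross v x y := by
        simp only [cross, hw, PiLp.add_apply, PiLp.smul_apply, smul_eq_mul]; ring
      rw [this, abs_mul, abs_of_pos hc, pow_succ', ← div_div]
      gcongr
      nlinarith [abs_nonneg (cross v x y)]
    · obtain ⟨v', x', y', hT, hle'⟩ := ih hT₁
      refine ⟨v', x', y', hT, hle'.trans ?_⟩
      have : cross u v y = -(b' * cross v x y) := by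
        simp only [cross, hu, PiLp.add_apply, PiLp.smul_apply, smul_eq_mul]; ring
      rw [this, abs_neg, abs_mul, abs_of_pos hb', pow_succ', ← div_div]
      gcongr
      nlinarith [abs_nonneg (cross v x y)]

lemma SidesIn.separated {m M s : ℝ} {f : Plane →ₗ[ℝ] ℝ} {S : Set Plane} {v x y : Plane}
    (hf : ∀ p ∈ S, ∀ q ∈ S, m ≤ dist p q → s ≤ |f p - f q|)
    (h : SidesIn m M v x y) (hv : v ∈ S) (hx : x ∈ S) (hy : y ∈ S) :
    s ≤ |f v - f x| ∧ s ≤ |f v - f y| ∧ s ≤ |f x - f y| :=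
  ⟨hf _ hv _ hx h.1.1, hf _ hv _ hy h.2.1.1, hf _ hx _ hy h.2.2.1⟩

lemma Convex.combo_mem {E : Type*} [AddCommGroup E] [Module ℝ E] {S : Set E} (hS : Convex ℝ S)
    {v x y : E} {b c : ℝ} (hv : v ∈ S) (hx : x ∈ S) (hy : y ∈ S)
    (hb : 0 < b) (hc : 0 < c) (hbc : b + c < 1) : (1 - b - c) • v + b • x + c • y ∈ S := by
  have h := hS hv (hS hx hy (div_nonneg hb.le (add_pos hb hc).le)
    (div_nonneg hc.le (add_pos hb hc).le) (by field_simp))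
    (by linarith : 0 ≤ 1 - b - c) (add_pos hb hc).le (by ring)
  convert h using 1
  match_scalars <;> field_simp

/-- If `f` separates the endpoints of all long segments in a convex set `S`, then a nested tree in
`S` whose root apex has its `f`-value between those of the base points has small depth. -/
lemma NestedTree.depth_mul_le {m M s : ℝ} (hs : 0 < s) {S : Set Plane} (hS : Convex ℝ S) (n : ℕ)
    {f : Plane →ₗ[ℝ] ℝ} (hf : ∀ p ∈ S, ∀ q ∈ S, m ≤ dist p q → s ≤ |f p - f q|)
    {v x y : Plane} (h : NestedTree m M n v x y) (hv : v ∈ S) (hx : x ∈ S) (hy : y ∈ S)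
    (hxv : f x < f v ∧ f v < f y ∨ f y < f v ∧ f v < f x) :
    n * s ≤ |f x - f y| := by
  induction n generalizing v x y f with
  | zero => simp
  | succ n ih =>
    wlog hlt : f x < f v ∧ f v < f y generalizing f
    · have hneg := @this (-f) (fun p hp q hq hpq => by
        simpa [neg_add_eq_sub, abs_sub_comm] using hf p hp q hq hpq)
        (by simpa [or_comm, and_comm] using hxv)
        (by simpa only [LinearMap.neg_apply, neg_lt_neg_iff, and_comm] using hxv.resolve_left hlt)
      simpa [neg_add_eq_sub, abs_sub_comm] using hneg
    obtain ⟨hsides, w, u, b, c, b', c', hw, hu, hb, hc, hbc, hb', hc', hbc', hle, hT₀, hT₁⟩ := h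
    have hwS : w ∈ S := hw ▸ hS.combo_mem hv hx hy hb hc hbc
    have huS : u ∈ S := hu ▸ hS.combo_mem hv hx hy hb' hc' hbc'
    have hfw : f w = f v - b * (f v - f x) + c * (f y - f v) := by simp [hw]; ring
    have hfu : f u = f v - b' * (f v - f x) + c' * (f y - f v) := by simp [hu]; ring
    obtain ⟨sx, sy, -⟩ := hsides.separated hf hv hx hy
    obtain ⟨sw, -, -⟩ := hT₀.sidesIn.separated hf hwS hv hx
    obtain ⟨su, -, -⟩ := hT₁.sidesIn.separated hf huS hv hy
    obtain ⟨hxv', hvy⟩ := hlt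
    rw [abs_of_pos (by linarith)] at sx
    rw [abs_of_neg (by linarith)] at sy
    rw [abs_of_neg (by linarith)]
    push_cast
    rcases lt_trichotomy (f w) (f v) with hwv | hwv | hwv
    · have := ih hf hT₀ hwS hv hx (Or.inr ⟨by nlinarith, hwv⟩)
      rw [abs_of_pos (by linarith)] at this
      linarith
    · simp [hwv] at sw; linarith
    · rcases lt_trichotomy (f u) (f v) with huv | huv | huv
      · have e₁ : b * (f v - f x) < c * (f y - f v) := by linarith
        have e₂ : c' * (f y - f v) < b' * (f v - f x) := by linarith
        have hp : 0 < (f v - f x) * (f y - f v) := mul_pos (by linarith) (by linarith)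
        have h0 : 0 < c' * (f y - f v) := mul_pos hc' (by linarith)
        have h1 : 0 < c * (f y - f v) := mul_pos hc (by linarith)
        have := mul_lt_mul e₁ e₂.le h0 h1.le
        nlinarith
      · simp [huv] at su; linarith
      · have := ih hf hT₁ huS hv hy (Or.inl ⟨huv, by nlinarith⟩)
        rw [abs_of_neg (by linarith)] at this
        linarith

lemma NestedTree.depth_mul_le_of_separated {m M s B : ℝ} (hs : 0 < s) {S : Set Plane}
    (hS : Convex ℝ S) (n : ℕ)
    {f : Plane →ₗ[ℝ] ℝ} (hf : ∀ p ∈ S, ∀ q ∈ S, m ≤ dist p q → s ≤ |f p - f q|)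
    (hB : ∀ p q, dist p q ≤ M → |f p - f q| ≤ B)
    {v x y : Plane} (h : NestedTree m M (n + 1) v x y) (hv : v ∈ S) (hx : x ∈ S) (hy : y ∈ S) :
    n * s ≤ B := by
  have hsides := h.sidesIn
  obtain ⟨sx, sy, sxy⟩ := hsides.separated hf hv hx hy
  have n1 : f v ≠ f x := fun e => by simp [e] at sx; linarith
  have n2 : f v ≠ f y := fun e => by simp [e] at sy; linarith
  have n3 : f x ≠ f y := fun e => by simp [e] at sxy; linarith
  by_cases hA : f x < f v ∧ f v < f y ∨ f y < f v ∧ f v < f x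
  · have := h.depth_mul_le hs hS _ hf hv hx hy hA
    have := hB _ _ hsides.2.2.2
    push_cast at *
    linarith
  obtain ⟨-, w, u, b, c, b', c', hw, hu, hb, hc, hbc, hb', hc', hbc', hle, hT₀, hT₁⟩ := h
  have hwS : w ∈ S := hw ▸ hS.combo_mem hv hx hy hb hc hbc
  have huS : u ∈ S := hu ▸ hS.combo_mem hv hx hy hb' hc' hbc'
  have hfw : f w = f v - b * (f v - f x) - c * (f v - f y) := by simp [hw]; ring
  have hfu : f u = f v - b' * (f v - f x) - c' * (f v - f y) := by simp [hu]; ring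
  rcases n1.lt_or_gt with h1 | h1 <;> rcases n2.lt_or_gt with h2 | h2 <;>
    rcases n3.lt_or_gt with h3 | h3
  · exact (hT₁.depth_mul_le hs hS _ hf huS hv hy (Or.inl ⟨by nlinarith, by nlinarith⟩)).trans
      (hB _ _ hsides.2.1.2)
  · exact (hT₀.depth_mul_le hs hS _ hf hwS hv hx (Or.inl ⟨by nlinarith, by nlinarith⟩)).trans
      (hB _ _ hsides.1.2)
  · exact absurd (Or.inr ⟨h2, h1⟩) hA
  · exact absurd (Or.inr ⟨h2, h1⟩) hA
  · exact absurd (Or.inl ⟨h1, h2⟩) hA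
  · exact absurd (Or.inl ⟨h1, h2⟩) hA
  · exact (hT₀.depth_mul_le hs hS _ hf hwS hv hx (Or.inr ⟨by nlinarith, by nlinarith⟩)).trans
      (hB _ _ hsides.1.2)
  · exact (hT₁.depth_mul_le hs hS _ hf huS hv hy (Or.inr ⟨by nlinarith, by nlinarith⟩)).trans
      (hB _ _ hsides.2.1.2)

lemma dist_sq_plane (p q : Plane) : dist p q ^ 2 = (p 0 - q 0) ^ 2 + (p 1 - q 1) ^ 2 := by
  rw [EuclideanSpace.dist_sq_eq]
  simp [Real.dist_eq, sq_abs]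

/-- A nested tree whose root triangle is thin has depth at most about `2 M / m`. -/
lemma NestedTree.depth_le_of_thin {m M : ℝ} (hm : 0 < m) (n : ℕ) {v x y : Plane}
    (h : NestedTree m M (n + 1) v x y) (hthin : |cross v x y| ≤ m ^ 2 / 2) :
    n * m ≤ 2 * M := by
  have hsides := h.sidesIn
  set L := dist x y with hL
  have hmL : m ≤ L := hsides.2.2.1
  have hM : 0 < M := hm.trans_le (hmL.trans hsides.2.2.2)
  have hL0 : 0 < L := hm.trans_le hmL
  have hL2 := dist_sq_plane x y
  let f : Plane →ₗ[ℝ] ℝ :=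
    (y 0 - x 0) • (EuclideanSpace.proj 0 : Plane →L[ℝ] ℝ).toLinearMap +
      (y 1 - x 1) • (EuclideanSpace.proj 1 : Plane →L[ℝ] ℝ).toLinearMap
  let g : Plane →ₗ[ℝ] ℝ :=
    (y 0 - x 0) • (EuclideanSpace.proj 1 : Plane →L[ℝ] ℝ).toLinearMap -
      (y 1 - x 1) • (EuclideanSpace.proj 0 : Plane →L[ℝ] ℝ).toLinearMap
  have hfa : ∀ p, f p = (y 0 - x 0) * p 0 + (y 1 - x 1) * p 1 := fun p => by simp [f]
  have hga : ∀ p, g p = (y 0 - x 0) * p 1 - (y 1 - x 1) * p 0 := fun p => by simp [g]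
  have hfg : ∀ p q, (f p - f q) ^ 2 + (g p - g q) ^ 2 = (L * dist p q) ^ 2 := fun p q => by
    rw [mul_pow, dist_sq_plane p q, hL2, hfa, hfa, hga, hga]; ring
  have hgv : g v - g x = cross v x y := by rw [hga, hga, cross]; ring
  have hgy : g y = g x := by rw [hga, hga]; ring
  have hS : Convex ℝ (g ⁻¹' segment ℝ (g v) (g x)) := (convex_segment _ _).linear_preimage g
  have key : (n : ℝ) * (L * m / 2) ≤ L * M := by
    refine h.depth_mul_le_of_separated (by positivity) hS n (f := f) ?_ ?_
      (left_mem_segment ℝ _ _) (right_mem_segment ℝ _ _)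
      (by rw [Set.mem_preimage, hgy]; exact right_mem_segment ℝ _ _)
    · intro p hp q hq hpq
      have hgd : |g p - g q| ≤ m ^ 2 / 2 := by
        refine le_trans ?_ (hgv ▸ hthin)
        rw [Set.mem_preimage, segment_eq_uIcc] at hp hq
        rw [abs_sub_comm (g v)]
        exact Set.abs_sub_le_of_uIcc_subset_uIcc (Set.uIcc_subset_uIcc hq hp)
      refine abs_le_of_sq_le_sq' ?_ (abs_nonneg _) |>.2
      have e := hfg p q
      have e1 : L * m ≤ L * dist p q := by gcongr
      have e2 : (L * m) ^ 2 ≤ (L * dist p q) ^ 2 := by gcongr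
      have e3 : (g p - g q) ^ 2 ≤ (m ^ 2 / 2) ^ 2 := sq_le_sq' (abs_le.1 hgd).1 (abs_le.1 hgd).2
      have e4 : (m * m) ^ 2 ≤ (L * m) ^ 2 := by gcongr
      rw [sq_abs]
      nlinarith
    · intro p q hpq
      refine abs_le_of_sq_le_sq ?_ (by positivity)
      have e2 : (L * dist p q) ^ 2 ≤ (L * M) ^ 2 := by gcongr
      nlinarith [hfg p q, sq_nonneg (g p - g q)]
  have : L * (n * m) ≤ L * (2 * M) := by linarith
  exact le_of_mul_le_mul_left this hL0

lemma SidesIn.abs_cross_le {m M : ℝ} {v x y : Plane} (h : SidesIn m M v x y) :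
    |cross v x y| ≤ M ^ 2 := by
  have h1 : dist v x ^ 2 ≤ M ^ 2 := by gcongr; exact h.1.2
  have h2 : dist v y ^ 2 ≤ M ^ 2 := by gcongr; exact h.2.1.2
  rw [dist_sq_plane] at h1 h2
  rw [cross, abs_le]
  constructor <;>
    nlinarith [sq_nonneg (x 0 - v 0 - (y 1 - v 1)), sq_nonneg (x 0 - v 0 + (y 1 - v 1)),
      sq_nonneg (x 1 - v 1 - (y 0 - v 0)), sq_nonneg (x 1 - v 1 + (y 0 - v 0))]

/-- Nested trees with bounded ratio of side lengths have bounded depth. -/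
lemma exists_not_nestedTree (k : ℝ) :
    ∃ n : ℕ, ∀ m : ℝ, 0 < m → ∀ v x y, ¬ NestedTree m (k * m) n v x y := by
  obtain ⟨j, hj⟩ := pow_unbounded_of_one_lt (2 * k ^ 2) (one_lt_two : (1 : ℝ) < 2)
  obtain ⟨n, hn⟩ := exists_nat_gt (2 * k)
  refine ⟨n + 1 + j, fun m hm v x y h => ?_⟩
  obtain ⟨v', x', y', hT, hle⟩ := h.exists_small
  have := hT.depth_le_of_thin hm n (hle.trans ?_)
  · nlinarith
  · rw [div_le_iff₀ (by positivity)]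
    have := h.sidesIn.abs_cross_le
    nlinarith [pow_pos hm 2]

/-- The length of the string labelling a vertex, with value `0` on roots. -/
def strLength : Fin 3 ⊕ List Bool → ℕ
  | Sum.inl _ => 0
  | Sum.inr l => l.length

lemma strLength_parentPair_lt {σ : List Bool} (hσ : σ ≠ []) :
    strLength (parentPair σ).1 < σ.length ∧ strLength (parentPair σ).2 < σ.length := by
  induction σ with
  | nil => exact absurd rfl hσ
  | cons c τ ih =>
    cases τ with
    | nil => cases c <;> simp [parentPair, strLength]
    | cons d τ =>
      have := ih (by simp)
      cases c <;> simp [parentPair, strLength] at this ⊢ <;> omega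

lemma liftDraw_nVertIncl {n : ℕ} (ρ : NVert n → Plane) (a : NVert n) :
    liftDraw n ρ (nVertIncl a) = ρ a := by
  rcases a with i | ⟨l, hl⟩
  · rfl
  · simp only [nVertIncl, liftDraw]
    rw [dif_pos hl]

lemma nestedGraph_adj_of_parent {n : ℕ} {σ : List Bool} (h : σ ≠ [] ∧ σ.length ≤ n) {a : NVert n}
    (ha : nVertIncl a = (parentPair σ).1 ∨ nVertIncl a = (parentPair σ).2) :
    (nestedGraph n).Adj (Sum.inr ⟨σ, h⟩) a := by
  refine (SimpleGraph.fromRel_adj _ _ _).2 ⟨?_, Or.inr (Or.inr ⟨_, rfl, ha⟩)⟩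
  rintro rfl
  have := strLength_parentPair_lt h.1
  rcases ha with ha | ha <;> rw [← ha] at this <;> simp [nVertIncl, strLength] at this

lemma IsPlanarDrawing.disjoint_segment {V : Type} {G : SimpleGraph V} {ρ : V → Plane}
    (h : IsPlanarDrawing G ρ) {a b c d : V} (hab : G.Adj a b) (hcd : G.Adj c d)
    (hac : a ≠ c) (had : a ≠ d) (hbc : b ≠ c) (hbd : b ≠ d) :
    Disjoint (segment ℝ (ρ a) (ρ b)) (segment ℝ (ρ c) (ρ d)) := by
  rw [Set.disjoint_iff_inter_eq_empty, h.2.2 _ _ _ _ hab hcd (by simp [hac, had])]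
  refine Set.eq_empty_of_forall_notMem ?_
  rintro _ ⟨w, rfl | rfl, hw | hw, -⟩ <;> contradiction

lemma IsNestedDrawing.nestedTree {n : ℕ} {ρ : NVert n → Plane} (h : IsNestedDrawing n ρ) {m M : ℝ}
    (hlen : ∀ a b, (nestedGraph n).Adj a b → dist (ρ a) (ρ b) ∈ Set.Icc m M) (j : ℕ)
    {σ : List Bool} (hσ : σ ≠ [] ∧ σ.length ≤ n) (hj : σ.length + j ≤ n) {x y : NVert n}
    (hx : nVertIncl x = (parentPair σ).1) (hy : nVertIncl y = (parentPair σ).2)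
    (hxy : (nestedGraph n).Adj x y) :
    NestedTree m M j (ρ (Sum.inr ⟨σ, hσ⟩)) (ρ x) (ρ y) := by
  induction j generalizing σ x y with
  | zero =>
    exact ⟨hlen _ _ (nestedGraph_adj_of_parent hσ (Or.inl hx)),
      hlen _ _ (nestedGraph_adj_of_parent hσ (Or.inr hy)), hlen _ _ hxy⟩
  | succ j ih =>
    have avx := nestedGraph_adj_of_parent hσ (Or.inl hx)
    have avy := nestedGraph_adj_of_parent hσ (Or.inr hy)
    have hchild : ∀ c : Bool, c :: σ ≠ [] ∧ (c :: σ).length ≤ n := fun c =>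
      ⟨by simp, by simp; omega⟩
    have hpp : ∀ c : Bool, parentPair (c :: σ) =
        (Sum.inr σ, if c then (parentPair σ).2 else (parentPair σ).1) := fun c => by
      cases σ with
      | nil => exact absurd rfl hσ.1
      | cons d τ => cases c <;> simp [parentPair]
    set v : NVert n := Sum.inr ⟨σ, hσ⟩ with hv
    have hlt := strLength_parentPair_lt hσ.1
    have hnx : ∀ c, Sum.inr ⟨c :: σ, hchild c⟩ ≠ x := by
      rintro c rfl
      rw [← hx] at hlt
      simp [nVertIncl, strLength] at hlt
    have hny : ∀ c, Sum.inr ⟨c :: σ, hchild c⟩ ≠ y := by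
      rintro c rfl
      rw [← hy] at hlt
      simp [nVertIncl, strLength] at hlt
    have hnv : ∀ c, (nestedGraph n).Adj (Sum.inr ⟨c :: σ, hchild c⟩) v := fun c =>
      nestedGraph_adj_of_parent _ (Or.inl (by rw [hpp]; rfl))
    have awx : (nestedGraph n).Adj (Sum.inr ⟨false :: σ, hchild false⟩) x :=
      nestedGraph_adj_of_parent _ (Or.inr (by rw [hpp]; exact hx))
    have auy : (nestedGraph n).Adj (Sum.inr ⟨true :: σ, hchild true⟩) y :=
      nestedGraph_adj_of_parent _ (Or.inr (by rw [hpp]; exact hy))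
    have hbary : ∀ c, ∃ s t : ℝ, 0 < s ∧ 0 < t ∧ s + t < 1 ∧
        ρ (Sum.inr ⟨c :: σ, hchild c⟩) = (1 - s - t) • ρ v + s • ρ x + t • ρ y := fun c => by
      refine exists_pos_of_mem_convexHull ?_ (h.1.2.1 _ _ _ avx (hnv c).ne (hnx c))
        (h.1.2.1 _ _ _ avy (hnv c).ne (hny c)) (h.1.2.1 _ _ _ hxy (hnx c) (hny c))
      have := interior_subset (h.2.2 σ c hσ.1 (by omega) (hchild c))
      rwa [← hx, ← hy, liftDraw_nVertIncl, liftDraw_nVertIncl,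
        show (Sum.inr σ : Fin 3 ⊕ List Bool) = nVertIncl v from rfl, liftDraw_nVertIncl] at this
    obtain ⟨b, c, hb, hc, hbc, hw⟩ := hbary false
    obtain ⟨b', c', hb', hc', hbc', hu⟩ := hbary true
    refine ⟨⟨hlen _ _ avx, hlen _ _ avy, hlen _ _ hxy⟩, _, _, b, c, b', c', hw, hu,
      hb, hc, hbc, hb', hc', hbc',
      mul_le_mul_of_segments_disjoint hw hu hb hc hbc hb' hc' hbc' ?_ ?_ ?_, ?_, ?_⟩
    · exact h.1.disjoint_segment (hnv true).symm awx.symm avx.ne (hnv false).ne' (hnx true) (by simp)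
    · exact h.1.disjoint_segment (hnv false).symm auy.symm avy.ne (hnv true).ne' (hny false)
        (by simp)
    · exact h.1.disjoint_segment awx.symm auy.symm hxy.ne (hnx true).symm (hny false) (by simp)
    · exact ih (hchild false) (by simp; omega) (by rw [hpp]; rfl) (by rw [hpp]; exact hx) avx
    · exact ih (hchild true) (by simp; omega) (by rw [hpp]; rfl) (by rw [hpp]; exact hy) avy

/-- For every real `k ≥ 1` there is an integer `n ≥ 1` such that every
nested planar straight-line drawing of `G_n` has edge-length ratio at least `k`. -/
theorem nested_ratio_unbounded (k : ℝ) (hk : 1 ≤ k) :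
    ∃ n : ℕ, 1 ≤ n ∧
      ∀ ρ : NVert n → Plane, IsNestedDrawing n ρ →
        k ≤ edgeLengthRatio (nestedGraph n) ρ := by
  obtain ⟨n, hn⟩ := exists_not_nestedTree k
  refine ⟨n + 1, by omega, fun ρ hρ => ?_⟩
  by_contra! hlt
  have : Finite {l : List Bool // l ≠ [] ∧ l.length ≤ n + 1} :=
    ((List.finite_length_le Bool (n + 1)).subset fun _ hl => hl.2).to_subtype
  set D := {d : ℝ | ∃ u v, (nestedGraph (n + 1)).Adj u v ∧ d = dist (ρ u) (ρ v)} with hD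
  have hfin : D.Finite := by
    refine (Set.finite_range fun p : NVert (n + 1) × NVert (n + 1) =>
      dist (ρ p.1) (ρ p.2)).subset ?_
    rintro _ ⟨u, v, -, rfl⟩
    exact ⟨(u, v), rfl⟩
  have hadj : (nestedGraph (n + 1)).Adj (Sum.inl 0) (Sum.inl 2) :=
    (SimpleGraph.fromRel_adj _ _ _).2 ⟨by simp, Or.inl (Or.inl ⟨0, 2, rfl, rfl⟩)⟩
  have hne : D.Nonempty := ⟨_, _, _, hadj, rfl⟩
  have hpos : 0 < sInf D := by
    obtain ⟨u, v, huv, he⟩ := hne.csInf_mem hfin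
    rw [he]
    exact dist_pos.2 (hρ.1.1.ne huv.ne)
  rw [edgeLengthRatio, ← hD, div_lt_iff₀ hpos] at hlt
  refine hn _ hpos _ _ _ (hρ.nestedTree (fun a b hab => ?_) n (σ := [false]) ⟨by simp, by simp⟩
    (by simp; omega) (x := Sum.inl 0) (y := Sum.inl 2) rfl rfl hadj)
  exact ⟨csInf_le hfin.bddBelow ⟨a, b, hab, rfl⟩,
    (le_csSup hfin.bddAbove ⟨a, b, hab, rfl⟩).trans hlt.le⟩
end
end
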